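/- arXiv:2307.15866 — 2 statements merged into one kernel-verified Lean document; each statement's English description precedes it below -/
import Mathlib

section
/- For 1 ≤ i ≤ m and b ∈ ℤ define the operator E_i(b) on F_N(S) by E_i(b) := Σ_{r∈S} q^{−br} Σ_{k=1}^{n} :psi_i^k(−r) psibar_i^k(r): − n·ω_S(b)·Id. Then for every 1 ≤ l ≤ n: E_i(b)(A_l|0⟩) = ( Σ_{r∈J^S_{i,l}} q^{−br} + εn − nω_S(b) ) A_l|0⟩, and E_i(b)(Abar_l|0⟩) = ( − Σ_{r∈Jbar^S_{i,n−l+1}} q^{−br} + εn − nω_S(b) ) Abar_l|0⟩. -/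
noncomputable section

/-- Context for the enlarged Weyl algebra `W_N(S)` with `N = m·n` and
`S = ℤ` (encoded by `sig = 0`) or `S = ℤ + 1/2` (encoded by `sig = 1`).
An element `r ∈ S` is encoded by the unique integer `k` with `r = k + sig/2`,
so that `ε := 1/2 - sig/2` and e.g. `r > 0 ↔ 0 < 2k + sig`.
The data also fixes a generic `q ∈ ℂˣ` together with a square root `sq` of `q`. -/
structure WCtx where
  m : ℕ
  n : ℕ
  hm : 0 < m
  hn : 0 < n
  sig : ℤ
  hsig : sig = 0 ∨ sig = 1
  q : ℂ
  sq : ℂ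
  hsq : sq ^ 2 = q
  hq0 : q ≠ 0
  hqu : ∀ k : ℕ, k ≠ 0 → q ^ k ≠ 1

namespace WCtx

variable (C : WCtx)

/-- `N = m n`. -/
def NN : ℕ := C.m * C.n

/-- Names of the generators of `W_N(S)`: `Sum.inl i` is `ψ_{i+1}` and
`Sum.inr i` is `ψ̄_{i+1}`; the integer `k` encodes the index `r = k + sig/2 ∈ S`. -/
abbrev Gen : Type := (Fin C.NN ⊕ Fin C.NN) × ℤ

/-- The defining relations of the enlarged Weyl algebra `W_N(S)`:
any two `ψ`'s commute, any two `ψ̄`'s commute, and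
`ψ̄_i(k)ψ_j(r) − ψ_j(r)ψ̄_i(k) = δ_{i,j} δ_{k+r,0}`. -/
inductive rel : FreeAlgebra ℂ C.Gen → FreeAlgebra ℂ C.Gen → Prop
  | comm_psi (i j : Fin C.NN) (k l : ℤ) :
      rel (FreeAlgebra.ι ℂ ((Sum.inl i, k) : C.Gen) * FreeAlgebra.ι ℂ ((Sum.inl j, l) : C.Gen))
          (FreeAlgebra.ι ℂ ((Sum.inl j, l) : C.Gen) * FreeAlgebra.ι ℂ ((Sum.inl i, k) : C.Gen))
  | comm_psibar (i j : Fin C.NN) (k l : ℤ) :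
      rel (FreeAlgebra.ι ℂ ((Sum.inr i, k) : C.Gen) * FreeAlgebra.ι ℂ ((Sum.inr j, l) : C.Gen))
          (FreeAlgebra.ι ℂ ((Sum.inr j, l) : C.Gen) * FreeAlgebra.ι ℂ ((Sum.inr i, k) : C.Gen))
  | mixed (i j : Fin C.NN) (k l : ℤ) :
      rel (FreeAlgebra.ι ℂ ((Sum.inr i, k) : C.Gen) * FreeAlgebra.ι ℂ ((Sum.inl j, l) : C.Gen))
          (FreeAlgebra.ι ℂ ((Sum.inl j, l) : C.Gen) * FreeAlgebra.ι ℂ ((Sum.inr i, k) : C.Gen)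
            + (if i = j ∧ k + l + C.sig = 0 then 1 else 0))

/-- The enlarged Weyl algebra `W_N(S)`. -/
def W : Type := RingQuot C.rel

instance : Ring C.W := inferInstanceAs (Ring (RingQuot C.rel))
instance : Algebra ℂ C.W := inferInstanceAs (Algebra ℂ (RingQuot C.rel))

/-- `ψ` with `0`-indexed flat subscript. -/
def psi0 (i : Fin C.NN) (k : ℤ) : C.W :=
  RingQuot.mkAlgHom ℂ C.rel (FreeAlgebra.ι ℂ ((Sum.inl i, k) : C.Gen))

/-- `ψ̄` with `0`-indexed flat subscript. -/
def psibar0 (i : Fin C.NN) (k : ℤ) : C.W :=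
  RingQuot.mkAlgHom ℂ C.rel (FreeAlgebra.ι ℂ ((Sum.inr i, k) : C.Gen))

/-- `ψ_i(r)` with `1`-indexed flat subscript `i ∈ {1,…,N}` (junk value `0` outside). -/
def psiF (i : ℕ) (k : ℤ) : C.W :=
  if h : 1 ≤ i ∧ i ≤ C.NN then C.psi0 ⟨i - 1, by omega⟩ k else 0

/-- `ψ̄_i(r)` with `1`-indexed flat subscript `i ∈ {1,…,N}` (junk value `0` outside). -/
def psibarF (i : ℕ) (k : ℤ) : C.W :=
  if h : 1 ≤ i ∧ i ≤ C.NN then C.psibar0 ⟨i - 1, by omega⟩ k else 0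

/-- `ψ_i^c(r) = ψ_{i+(c-1)m}(r)`, subscript `i ∈ {1,…,m}`, superscript `c ∈ {1,…,n}`. -/
def psiS (i c : ℕ) (k : ℤ) : C.W := C.psiF (i + (c - 1) * C.m) k

/-- `ψ̄_i^c(r) = ψ̄_{i+(c-1)m}(r)`. -/
def psibarS (i c : ℕ) (k : ℤ) : C.W := C.psibarF (i + (c - 1) * C.m) k

/-- The left ideal of `W_N(S)` generated by all `ψ_i(r), ψ̄_i(r)` with `r > 0`,
together with all `ψ̄_i(0)` when `S = ℤ`. -/
def vacIdeal : Submodule C.W C.W :=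
  Submodule.span C.W
    {w : C.W |
      (∃ (i : Fin C.NN) (k : ℤ), 0 < 2 * k + C.sig ∧ (w = C.psi0 i k ∨ w = C.psibar0 i k)) ∨
        (C.sig = 0 ∧ ∃ i : Fin C.NN, w = C.psibar0 i 0)}

/-- The Fock module `F_N(S) = W_N(S)/I`. -/
def F : Type := C.W ⧸ C.vacIdeal

instance : AddCommGroup C.F := inferInstanceAs (AddCommGroup (C.W ⧸ C.vacIdeal))
instance : Module C.W C.F := inferInstanceAs (Module C.W (C.W ⧸ C.vacIdeal))
instance : Module ℂ C.F := inferInstanceAs (Module ℂ (C.W ⧸ C.vacIdeal))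

/-- The vacuum vector `|0⟩ ∈ F_N(S)`. -/
def vac : C.F := Submodule.Quotient.mk (1 : C.W)

/-- Normal ordering `:u(k) v(l):` where `l` encodes the `S`-index of the second factor. -/
def nord (u : C.W) (l : ℤ) (v : C.W) : C.W :=
  if 0 < 2 * l + C.sig then u * v
  else if 2 * l + C.sig = 0 then (2 : ℂ)⁻¹ • (u * v + v * u)
  else v * u

/-- `ε = 0` if `S = ℤ + 1/2`, `ε = 1/2` if `S = ℤ`, as a complex number. -/
def eps : ℂ := (1 - (C.sig : ℂ)) / 2

/-- `ω_S(b)`. -/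
def om (b : ℤ) : ℂ :=
  if b = 0 then 0
  else if C.sig = 0 then (2 : ℂ)⁻¹ * ((C.q ^ b + 1) / (C.q ^ b - 1))
  else C.sq ^ b / (C.q ^ b - 1)

/-- `q^{-b r}` for `r = k + sig/2 ∈ S`. -/
def qp (b k : ℤ) : ℂ := C.sq ^ (-(b * (2 * k + C.sig)))

/-- `q^{b r}` for `r = k + sig/2 ∈ S`. -/
def qpp (b k : ℤ) : ℂ := C.sq ^ (b * (2 * k + C.sig))

/-- `φ^c_{t + sig/2}`; here `t ∈ ℤ` encodes the half-integer index `t + sig/2 = t + 1/2 - ε`.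
Writing `t = (k + sig)m - i` with `1 ≤ i ≤ m`, `k ∈ ℤ`, this is `ψ_i^c(k + sig/2)`. -/
def PhiW (c : ℕ) (t : ℤ) : C.W :=
  C.psiF ((((-t - 1).emod C.m).toNat + 1) + (c - 1) * C.m)
    ((t + (-t - 1).emod C.m + 1) / C.m - C.sig)

/-- `φ̄^c_{t + sig/2}`; writing `t = k·m + i - 1` with `1 ≤ i ≤ m`, `k ∈ ℤ`,
this is `ψ̄_i^c(k + sig/2)`. -/
def PhibarW (c : ℕ) (t : ℤ) : C.W :=
  C.psibarF (((t.emod C.m).toNat + 1) + (c - 1) * C.m) ((t - t.emod C.m) / C.m)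

/-- Determinant of a square matrix with (pairwise commuting) entries in `W_N(S)`. -/
def ncdet {l : ℕ} (M : Fin l → Fin l → C.W) : C.W :=
  ∑ p : Equiv.Perm (Fin l),
    (((Equiv.Perm.sign p : ℤˣ) : ℤ)) • ((List.finRange l).map fun t => M (p t) t).prod

/-- The element `A_l ∈ W_N(S)`, `1 ≤ l ≤ n`. -/
def Adet (l : ℕ) : C.W :=
  C.ncdet fun k t : Fin l => C.PhiW ((k : ℕ) + 1) (-(((t : ℕ) : ℤ) + 1))

/-- The element `Ā_l ∈ W_N(S)`, `1 ≤ l ≤ n`. -/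
def Abar (l : ℕ) : C.W :=
  C.ncdet fun s t : Fin (C.n - l + 1) => C.PhibarW (C.n - (s : ℕ)) (-(((t : ℕ) : ℤ) + 1))

/-- `α(r,a,i) = (a - r + 1/2 - ε)m - i + 1 = (a-k)m - i + 1` for `r = k + sig/2`. -/
def alphaV (k a : ℤ) (i : ℕ) : ℤ := (a - k) * C.m - (i : ℤ) + 1

/-- `β(r,a,j) = (r + a - 1/2 + ε)m + j = (k+a)m + j` for `r = k + sig/2`. -/
def betaV (k a : ℤ) (j : ℕ) : ℤ := (k + a) * C.m + (j : ℤ)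

/-- `Σ_{c=1}^{n} ψ_i^c(a-r) ψ̄_j^c(r)`, where `k` encodes `r`. -/
def Esum (i j : ℕ) (a k : ℤ) : C.W :=
  ∑ c : Fin C.n, C.psiS i ((c : ℕ) + 1) (a - k - C.sig) * C.psibarS j ((c : ℕ) + 1) k

/-- `A_l^{i,j,r}`: `A_l` with the `β(r,0,j)`-th column replaced by
`(φ^1_{α(r,a,i)-1/2-ε}, …, φ^l_{α(r,a,i)-1/2-ε})ᵗ`. -/
def Amod (l : ℕ) (i j : ℕ) (a k : ℤ) : C.W :=
  C.ncdet fun r t : Fin l =>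
    if (((t : ℕ) : ℤ) + 1) = C.betaV k 0 j then C.PhiW ((r : ℕ) + 1) (C.alphaV k a i - 1)
    else C.PhiW ((r : ℕ) + 1) (-(((t : ℕ) : ℤ) + 1))

/-- `Ā_l^{i,j,r}`: `Ā_l` with the `α(r,a,i)`-th column replaced by
`(-φ̄^n_{β(r,0,j)-1/2-ε}, …, -φ̄^l_{β(r,0,j)-1/2-ε})ᵗ`. -/
def Abarmod (l : ℕ) (i j : ℕ) (a k : ℤ) : C.W :=
  C.ncdet fun s t : Fin (C.n - l + 1) =>
    if (((t : ℕ) : ℤ) + 1) = C.alphaV k a i then -C.PhibarW (C.n - (s : ℕ)) (C.betaV k 0 j - 1)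
    else C.PhibarW (C.n - (s : ℕ)) (-(((t : ℕ) : ℤ) + 1))

/-- `l̄₁` for `l = l₁ m + l₂`, `1 ≤ l₂ ≤ m`. -/
def lb1 (l : ℕ) : ℕ :=
  if (l - 1) / C.m % 2 = 0 then ((l - 1) / C.m / 2) * C.m + ((l - 1) % C.m + 1)
  else (((l - 1) / C.m + 1) / 2) * C.m

/-- `l̄₂ = l - l̄₁`. -/
def lb2 (l : ℕ) : ℕ := l - C.lb1 l

/-- The `(k,t)` entry of the matrix defining `B_l`. -/
def Bentry (l : ℕ) (k t : Fin l) : C.W :=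
  if (t : ℕ) + 1 ≤ C.lb1 l then C.PhiW ((k : ℕ) + 1) (-(((t : ℕ) : ℤ) + 1))
  else C.PhibarW (C.n - (k : ℕ)) (-((((t : ℕ) : ℤ) + 1) - (C.lb1 l : ℤ)))

/-- The element `B_l ∈ W_N(S)`, `1 ≤ l ≤ n`. -/
def Bdet (l : ℕ) : C.W := C.ncdet (C.Bentry l)

/-- The element `B̄_{n/2} ∈ W_N(S)` (`n` even): `B_{n/2}` with its `(n/2)`-th row replaced. -/
def Bbar : C.W :=
  C.ncdet fun k t : Fin (C.n / 2) =>
    if (k : ℕ) + 1 = C.n / 2 then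
      (if (t : ℕ) + 1 ≤ C.lb1 (C.n / 2) then C.PhiW (C.n / 2 + 1) (-(((t : ℕ) : ℤ) + 1))
       else C.PhibarW (C.n / 2) (-((((t : ℕ) : ℤ) + 1) - (C.lb1 (C.n / 2) : ℤ))))
    else C.Bentry (C.n / 2) k t

/-- `B_l` with its `pos`-th column replaced by the column `(col 1, …, col l)ᵗ`. -/
def Bcolrep (l : ℕ) (pos : ℤ) (col : ℕ → C.W) : C.W :=
  C.ncdet fun k t : Fin l =>
    if (((t : ℕ) : ℤ) + 1) = pos then col ((k : ℕ) + 1) else C.Bentry l k t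

/-- The operator `T_{i,j}(a,b) = Σ_{r∈S} q^{-br} Σ_{c=1}^n :ψ_i^c(a-r) ψ̄_j^c(r):`. -/
def Top (i j : ℕ) (a b : ℤ) (x : C.F) : C.F :=
  ∑ᶠ k : ℤ, (C.qp b k • ∑ c : Fin C.n,
    C.nord (C.psiS i ((c : ℕ) + 1) (a - k - C.sig)) k (C.psibarS j ((c : ℕ) + 1) k)) • x

/-- The operator `S_{i,j}(c,d) = Σ_{e=1}^n ψ_i^e(c) ψ̄_j^e(d)`. -/
def Sop (i j : ℕ) (c d : ℤ) (x : C.F) : C.F :=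
  (∑ e : Fin C.n, C.psiS i ((e : ℕ) + 1) c * C.psibarS j ((e : ℕ) + 1) d) • x

/-- The operator `E_{p,p} = Σ_{c=1}^m Σ_{r∈S} :ψ_c^p(-r) ψ̄_c^p(r): − ε m`. -/
def Epp (p : ℕ) (x : C.F) : C.F :=
  (∑ᶠ k : ℤ, (∑ c : Fin C.m,
      C.nord (C.psiS ((c : ℕ) + 1) p (-k - C.sig)) k (C.psibarS ((c : ℕ) + 1) p k)) • x)
    - (C.eps * (C.m : ℂ)) • x

/-- The operator `E_i(b) = Σ_{r∈S} q^{-br} Σ_{c=1}^n :ψ_i^c(-r) ψ̄_i^c(r): − n ω_S(b)`. -/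
def Eib (i : ℕ) (b : ℤ) (x : C.F) : C.F :=
  (∑ᶠ k : ℤ, (C.qp b k • ∑ c : Fin C.n,
      C.nord (C.psiS i ((c : ℕ) + 1) (-k - C.sig)) k (C.psibarS i ((c : ℕ) + 1) k)) • x)
    - ((C.n : ℂ) * C.om b) • x

/-- `Σ_{r ∈ J^S_{i,l}} q^{-br}`. -/
def Jsum (i l : ℕ) (b : ℤ) : ℂ :=
  ∑ᶠ k ∈ {k : ℤ | 1 ≤ k * (C.m : ℤ) + (i : ℤ) ∧ k * (C.m : ℤ) + (i : ℤ) ≤ (l : ℤ)}, C.qp b k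

/-- `Σ_{r ∈ J̄^S_{i,l}} q^{-br}`. -/
def Jbarsum (i l : ℕ) (b : ℤ) : ℂ :=
  ∑ᶠ k ∈ {k : ℤ | 1 ≤ -(k * (C.m : ℤ)) - (i : ℤ) + 1 ∧ -(k * (C.m : ℤ)) - (i : ℤ) + 1 ≤ (l : ℤ)},
    C.qp b k

/-- `Σ_{r ∈ J^S_{i,l}} q^{br}`. -/
def JsumP (i l : ℕ) (b : ℤ) : ℂ :=
  ∑ᶠ k ∈ {k : ℤ | 1 ≤ k * (C.m : ℤ) + (i : ℤ) ∧ k * (C.m : ℤ) + (i : ℤ) ≤ (l : ℤ)}, C.qpp b k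

/-- `Σ_{c=1}^m ψ_c^p(-r) ψ̄_c^{p+1}(r)` (no normal ordering), `k` encoding `r ∈ S`. -/
def glRaise (p : ℕ) (k : ℤ) : C.W :=
  ∑ c : Fin C.m, C.psiS ((c : ℕ) + 1) p (-k - C.sig) * C.psibarS ((c : ℕ) + 1) (p + 1) k

/-- The operator `Σ_{c=1}^m Σ_{r∈S} :ψ_c^p(-r) ψ̄_c^{p+1}(r):`. -/
def glRaiseOp (p : ℕ) (x : C.F) : C.F :=
  ∑ᶠ k : ℤ, (∑ c : Fin C.m,
    C.nord (C.psiS ((c : ℕ) + 1) p (-k - C.sig)) k (C.psibarS ((c : ℕ) + 1) (p + 1) k)) • x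

end WCtx

namespace WCtx

variable (C : WCtx)

instance : IsScalarTower ℂ C.W C.F :=
  inferInstanceAs (IsScalarTower ℂ C.W (C.W ⧸ C.vacIdeal))

/-- An eigenvector relation `D x = x (D + λ)` propagates to products, the eigenvalues adding up. -/
theorem mul_prod_map_of_commutator {R A ι : Type*} [CommRing R] [Ring A] [Algebra R A] (D : A)
    (f : ι → A) (μ : ι → R) (L : List ι) (h : ∀ t ∈ L, D * f t = f t * D + μ t • f t) :
    D * (L.map f).prod = (L.map f).prod * D + (L.map μ).sum • (L.map f).prod := by
  induction L with
  | nil => simp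
  | cons a L ih =>
    have h1 := h a (by simp)
    have h2 := ih fun t ht => h t (by simp [ht])
    simp only [List.map_cons, List.prod_cons, List.sum_cons]
    rw [← mul_assoc, h1, add_mul, mul_assoc, h2, mul_add, add_smul]
    simp only [mul_smul_comm, smul_mul_assoc, mul_assoc]
    abel

theorem mul_ncdet_of_commutator {l : ℕ} (D : C.W) (M : Fin l → Fin l → C.W) (μ : Fin l → ℂ)
    (h : ∀ k t, D * M k t = M k t * D + μ t • M k t) :
    D * C.ncdet M = C.ncdet M * D + (∑ t, μ t) • C.ncdet M := by
  unfold ncdet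
  rw [Finset.mul_sum, Finset.sum_mul, Finset.smul_sum, ← Finset.sum_add_distrib]
  refine Finset.sum_congr rfl fun p _ => ?_
  have := mul_prod_map_of_commutator D (fun t => M (p t) t) μ (List.finRange l)
    fun t _ => h (p t) t
  rw [mul_smul_comm, this, smul_add, smul_mul_assoc, Fin.sum_univ_def,
    smul_comm ((Equiv.Perm.sign p : ℤˣ) : ℤ) (List.map μ _).sum]

theorem psiF_mul_psiF (a j : ℕ) (k r : ℤ) :
    C.psiF a k * C.psiF j r = C.psiF j r * C.psiF a k := by
  unfold psiF
  split_ifs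
  any_goals simp only [mul_zero, zero_mul]
  have h := RingQuot.mkAlgHom_rel ℂ
    (rel.comm_psi (C := C) ⟨a - 1, by omega⟩ ⟨j - 1, by omega⟩ k r)
  rw [map_mul, map_mul] at h
  exact h

theorem psibarF_mul_psibarF (a j : ℕ) (k r : ℤ) :
    C.psibarF a k * C.psibarF j r = C.psibarF j r * C.psibarF a k := by
  unfold psibarF
  split_ifs
  any_goals simp only [mul_zero, zero_mul]
  have h := RingQuot.mkAlgHom_rel ℂ
    (rel.comm_psibar (C := C) ⟨a - 1, by omega⟩ ⟨j - 1, by omega⟩ k r)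
  rw [map_mul, map_mul] at h
  exact h

theorem psibarF_mul_psiF {a j : ℕ} (ha : 1 ≤ a ∧ a ≤ C.NN) (hj : 1 ≤ j ∧ j ≤ C.NN) (k r : ℤ) :
    C.psibarF a k * C.psiF j r
      = C.psiF j r * C.psibarF a k + if a = j ∧ k + r + C.sig = 0 then 1 else 0 := by
  unfold psibarF psiF
  rw [dif_pos ha, dif_pos hj]
  have h := RingQuot.mkAlgHom_rel ℂ
    (rel.mixed (C := C) ⟨a - 1, by omega⟩ ⟨j - 1, by omega⟩ k r)
  have e : ((⟨a - 1, by omega⟩ : Fin C.NN) = ⟨j - 1, by omega⟩) ↔ a = j := by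
    rw [Fin.mk.injEq]; omega
  rw [map_add, map_mul, map_mul, apply_ite (RingQuot.mkAlgHom ℂ C.rel), map_one, map_zero] at h
  simp only [e] at h
  exact h

theorem smul_vac_eq_zero {w : C.W} (h : w ∈ C.vacIdeal) : w • C.vac = 0 := by
  change (Submodule.Quotient.mk (w • (1 : C.W)) : C.W ⧸ C.vacIdeal) = 0
  rwa [smul_eq_mul, mul_one, Submodule.Quotient.mk_eq_zero]

theorem psiF_smul_vac (j : ℕ) {k : ℤ} (hk : 0 < 2 * k + C.sig) : C.psiF j k • C.vac = 0 := by
  unfold psiF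
  split_ifs
  · exact C.smul_vac_eq_zero (Submodule.subset_span (Or.inl ⟨_, k, hk, Or.inl rfl⟩))
  · exact zero_smul _ _

theorem psibarF_smul_vac (j : ℕ) {k : ℤ} (hk : 0 ≤ 2 * k + C.sig) :
    C.psibarF j k • C.vac = 0 := by
  unfold psibarF
  split_ifs
  · refine C.smul_vac_eq_zero (Submodule.subset_span ?_)
    rcases hk.lt_or_eq with hk | hk
    · exact Or.inl ⟨_, k, hk, Or.inr rfl⟩
    · have := C.hsig
      obtain rfl : k = 0 := by omega
      exact Or.inr ⟨by omega, _, rfl⟩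
  · exact zero_smul _ _

/-- The normally ordered density `Σ_c :ψ_i^c(-r) ψ̄_i^c(r):`. -/
def numOp (i : ℕ) (k : ℤ) : C.W :=
  ∑ c : Fin C.n, C.nord (C.psiS i ((c : ℕ) + 1) (-k - C.sig)) k (C.psibarS i ((c : ℕ) + 1) k)

theorem index_mem {i c : ℕ} (hi : 1 ≤ i) (hi' : i ≤ C.m) (hc : c < C.n) :
    1 ≤ i + c * C.m ∧ i + c * C.m ≤ C.NN := by
  refine ⟨by omega, ?_⟩
  have : (c + 1) * C.m ≤ C.n * C.m := Nat.mul_le_mul_right _ hc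
  unfold NN
  rw [mul_comm C.m]
  linarith

theorem index_inj {m i j c d : ℕ} (hi : 1 ≤ i) (hi' : i ≤ m) (hj : 1 ≤ j) (hj' : j ≤ m) :
    i + c * m = j + d * m ↔ i = j ∧ c = d := by
  refine ⟨fun h => ?_, by rintro ⟨rfl, rfl⟩; rfl⟩
  have hcd : c = d := by
    rcases lt_trichotomy c d with hlt | heq | hlt
    · have := Nat.mul_le_mul_right m hlt
      rw [Nat.succ_mul] at this; omega
    · exact heq
    · have := Nat.mul_le_mul_right m hlt
      rw [Nat.succ_mul] at this; omega
  subst hcd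
  exact ⟨by omega, rfl⟩

theorem nord_smul_vac {i c : ℕ} (hi : 1 ≤ i) (hi' : i ≤ C.m) (hc : c < C.n) (k : ℤ) :
    C.nord (C.psiS i (c + 1) (-k - C.sig)) k (C.psibarS i (c + 1) k) • C.vac
      = (if 2 * k + C.sig = 0 then (2 : ℂ)⁻¹ else 0) • C.vac := by
  have hmem := C.index_mem hi hi' hc
  unfold nord psiS psibarS
  simp only [Nat.add_sub_cancel]
  split_ifs with h1 h2 h2
  · omega
  · rw [mul_smul, C.psibarF_smul_vac _ h1.le, smul_zero, zero_smul]
  · rw [C.psibarF_mul_psiF hmem hmem, if_pos ⟨rfl, by ring⟩, smul_assoc, add_smul, add_smul,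
      mul_smul, C.psibarF_smul_vac _ h2.ge, smul_zero, zero_add, zero_add, one_smul]
  · rw [mul_smul, C.psiF_smul_vac _ (by omega), smul_zero, zero_smul]

theorem numOp_smul_vac {i : ℕ} (hi : 1 ≤ i) (hi' : i ≤ C.m) (k : ℤ) :
    C.numOp i k • C.vac = (if 2 * k + C.sig = 0 then (C.n : ℂ) / 2 else 0) • C.vac := by
  unfold numOp
  rw [Finset.sum_smul, Finset.sum_congr rfl fun c _ => C.nord_smul_vac hi hi' c.2 k,
    Finset.sum_const, Finset.card_univ, Fintype.card_fin, ← Nat.cast_smul_eq_nsmul ℂ, smul_smul]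
  congr 1
  split_ifs <;> ring

/-- Normal ordering only shifts `ψ_a(-r) ψ̄_a(r)` by a scalar. -/
theorem exists_nord_eq {a : ℕ} (ha : 1 ≤ a ∧ a ≤ C.NN) (k : ℤ) :
    ∃ z : ℂ, C.nord (C.psiF a (-k - C.sig)) k (C.psibarF a k)
      = C.psiF a (-k - C.sig) * C.psibarF a k + z • 1 := by
  have h := C.psibarF_mul_psiF ha ha k (-k - C.sig)
  rw [if_pos ⟨rfl, by ring⟩] at h
  unfold nord
  rw [h]
  split_ifs
  · exact ⟨0, by simp⟩
  · refine ⟨2⁻¹, ?_⟩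
    rw [← add_assoc, smul_add, ← two_smul ℂ, smul_smul]
    norm_num
  · exact ⟨1, by simp⟩

theorem nord_mul_psiF {a j : ℕ} (ha : 1 ≤ a ∧ a ≤ C.NN) (hj : 1 ≤ j ∧ j ≤ C.NN) (k r : ℤ) :
    C.nord (C.psiF a (-k - C.sig)) k (C.psibarF a k) * C.psiF j r
      = C.psiF j r * C.nord (C.psiF a (-k - C.sig)) k (C.psibarF a k)
        + (if a = j ∧ k + r + C.sig = 0 then (1 : ℂ) else 0) • C.psiF j r := by
  obtain ⟨z, hz⟩ := C.exists_nord_eq ha k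
  rw [hz, add_mul, mul_assoc, C.psibarF_mul_psiF ha hj, mul_add, ← mul_assoc,
    C.psiF_mul_psiF a j, mul_add, mul_smul_comm, smul_mul_assoc, one_mul, mul_one, mul_assoc]
  split_ifs with h
  · obtain ⟨rfl, h⟩ := h
    obtain rfl : r = -k - C.sig := by omega
    rw [one_smul, mul_one]; abel
  · rw [zero_smul, mul_zero]; abel

theorem nord_mul_psibarF {a j : ℕ} (ha : 1 ≤ a ∧ a ≤ C.NN) (hj : 1 ≤ j ∧ j ≤ C.NN) (k r : ℤ) :
    C.nord (C.psiF a (-k - C.sig)) k (C.psibarF a k) * C.psibarF j r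
      = C.psibarF j r * C.nord (C.psiF a (-k - C.sig)) k (C.psibarF a k)
        + (if a = j ∧ k = r then (-1 : ℂ) else 0) • C.psibarF j r := by
  obtain ⟨z, hz⟩ := C.exists_nord_eq ha k
  rw [hz, add_mul, mul_assoc, C.psibarF_mul_psibarF a j, mul_add, ← mul_assoc (C.psibarF j r),
    C.psibarF_mul_psiF hj ha, add_mul, mul_smul_comm, smul_mul_assoc, one_mul, mul_one,
    ← mul_assoc]
  by_cases h : a = j ∧ k = r
  · obtain ⟨rfl, rfl⟩ := h
    rw [if_pos ⟨rfl, by ring⟩, if_pos ⟨rfl, rfl⟩, neg_smul, one_smul, one_mul]; abel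
  · rw [if_neg h, if_neg (by omega), zero_smul, zero_mul]; abel

theorem sum_ite_index {M : Type*} [AddCommMonoid M] {n m i j d : ℕ} (hi : 1 ≤ i) (hi' : i ≤ m)
    (hj : 1 ≤ j) (hj' : j ≤ m) (hd : d < n) (P : Prop) [Decidable P] (x : M) :
    (∑ c : Fin n, if i + (c : ℕ) * m = j + d * m ∧ P then x else 0)
      = if i = j ∧ P then x else 0 := by
  simp only [index_inj hi hi' hj hj']
  by_cases h : i = j ∧ P
  · rw [if_pos h, Finset.sum_eq_single (⟨d, hd⟩ : Fin n)]
    · simp [h]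
    · intro c _ hc
      rw [if_neg]
      rintro ⟨⟨-, h'⟩, -⟩
      exact hc (Fin.ext h')
    · simp
  · rw [if_neg h]
    exact Finset.sum_eq_zero fun c _ => if_neg fun h' => h ⟨h'.1.1, h'.2⟩

theorem numOp_mul_psiF {i j d : ℕ} (hi : 1 ≤ i) (hi' : i ≤ C.m) (hj : 1 ≤ j) (hj' : j ≤ C.m)
    (hd : d < C.n) (k r : ℤ) :
    C.numOp i k * C.psiF (j + d * C.m) r = C.psiF (j + d * C.m) r * C.numOp i k
      + (if i = j ∧ k + r + C.sig = 0 then (1 : ℂ) else 0) • C.psiF (j + d * C.m) r := by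
  unfold numOp psiS psibarS
  simp only [Nat.add_sub_cancel]
  rw [Finset.sum_mul, Finset.mul_sum, Finset.sum_congr rfl fun c _ =>
    C.nord_mul_psiF (C.index_mem hi hi' c.2) (C.index_mem hj hj' hd) k r,
    Finset.sum_add_distrib, ← Finset.sum_smul, sum_ite_index hi hi' hj hj' hd]

theorem numOp_mul_psibarF {i j d : ℕ} (hi : 1 ≤ i) (hi' : i ≤ C.m) (hj : 1 ≤ j) (hj' : j ≤ C.m)
    (hd : d < C.n) (k r : ℤ) :
    C.numOp i k * C.psibarF (j + d * C.m) r = C.psibarF (j + d * C.m) r * C.numOp i k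
      + (if i = j ∧ k = r then (-1 : ℂ) else 0) • C.psibarF (j + d * C.m) r := by
  unfold numOp psiS psibarS
  simp only [Nat.add_sub_cancel]
  rw [Finset.sum_mul, Finset.mul_sum, Finset.sum_congr rfl fun c _ =>
    C.nord_mul_psibarF (C.index_mem hi hi' c.2) (C.index_mem hj hj' hd) k r,
    Finset.sum_add_distrib, ← Finset.sum_smul, sum_ite_index hi hi' hj hj' hd]

/-- Uniqueness of Euclidean division by `m` with remainders taken in `{1, …, m}`. -/
theorem eq_emod_and_eq_ediv_iff {m i : ℕ} (hi : 1 ≤ i) (hi' : i ≤ m) (u k : ℤ) :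
    (i = (u % m).toNat + 1 ∧ k = u / m) ↔ u + 1 = k * m + i := by
  have hm : (0 : ℤ) < m := by omega
  have h1 := Int.emod_nonneg u hm.ne'
  have h2 := Int.emod_lt_of_pos u hm
  have h3 := Int.emod_add_mul_ediv u m
  constructor
  · rintro ⟨h, rfl⟩
    rw [mul_comm]; omega
  · intro h
    have hu : u = (i - 1 : ℤ) + m * k := by linarith
    have e1 : u % m = i - 1 := by
      rw [hu, Int.add_mul_emod_self_left, Int.emod_eq_of_lt] <;> omega
    have e2 : u / m = k := by
      rw [hu, Int.add_mul_ediv_left _ _ hm.ne', Int.ediv_eq_zero_of_lt] <;> omega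
    omega

theorem toNat_emod_add_one_le {m : ℕ} (hm : 0 < m) (u : ℤ) : (u % m).toNat + 1 ≤ m := by
  have := Int.emod_lt_of_pos u (b := m) (by omega)
  have := Int.emod_nonneg u (b := m) (by omega)
  omega

theorem numOp_mul_PhiW {i d : ℕ} (hi : 1 ≤ i) (hi' : i ≤ C.m) (hd : d < C.n) (k t : ℤ) :
    C.numOp i k * C.PhiW (d + 1) t = C.PhiW (d + 1) t * C.numOp i k
      + (if -t = k * C.m + i then (1 : ℂ) else 0) • C.PhiW (d + 1) t := by
  have hm : (C.m : ℤ) ≠ 0 := by have := C.hm; omega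
  have hdiv : (t + (-t - 1) % C.m + 1) / C.m = -((-t - 1) / C.m) := by
    rw [show t + (-t - 1) % C.m + 1 = C.m * (-((-t - 1) / C.m)) by
      linarith [Int.emod_add_mul_ediv (-t - 1) C.m], Int.mul_ediv_cancel_left _ hm]
  have h := C.numOp_mul_psiF hi hi' (Nat.le_add_left 1 (((-t - 1) % C.m).toNat))
    (toNat_emod_add_one_le C.hm _) hd k (-((-t - 1) / C.m) - C.sig)
  have e : (i = ((-t - 1) % C.m).toNat + 1 ∧ k + (-((-t - 1) / C.m) - C.sig) + C.sig = 0)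
      ↔ -t = k * C.m + i := by
    rw [← sub_add_cancel (-t) 1, ← eq_emod_and_eq_ediv_iff hi hi', sub_add_cancel]
    exact and_congr_right fun _ => by constructor <;> intro h <;> linarith
  simp only [e] at h
  rw [← hdiv] at h
  exact h

theorem numOp_mul_PhibarW {i d : ℕ} (hi : 1 ≤ i) (hi' : i ≤ C.m) (hd : 1 ≤ d) (hd' : d ≤ C.n)
    (k t : ℤ) :
    C.numOp i k * C.PhibarW d t = C.PhibarW d t * C.numOp i k
      + (if t + 1 = k * C.m + i then (-1 : ℂ) else 0) • C.PhibarW d t := by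
  have hm : (C.m : ℤ) ≠ 0 := by have := C.hm; omega
  have hdiv : (t - t % C.m) / C.m = t / C.m := by
    rw [show t - t % C.m = C.m * (t / C.m) by
      linarith [Int.emod_add_mul_ediv t C.m], Int.mul_ediv_cancel_left _ hm]
  have h := C.numOp_mul_psibarF hi hi' (Nat.le_add_left 1 ((t % C.m).toNat))
    (toNat_emod_add_one_le C.hm _) (show d - 1 < C.n by omega) k (t / C.m)
  simp only [eq_emod_and_eq_ediv_iff hi hi'] at h
  rw [← hdiv] at h
  exact h

theorem sum_fin_ite_eq (l : ℕ) (u : ℤ) (x : ℂ) :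
    (∑ t : Fin l, if ((t : ℕ) : ℤ) + 1 = u then x else 0) = if 1 ≤ u ∧ u ≤ l then x else 0 := by
  split_ifs with h
  · rw [Finset.sum_eq_single (⟨(u - 1).toNat, by omega⟩ : Fin l)]
    · rw [if_pos]; simp only; omega
    · intro t _ ht
      rw [if_neg]
      intro h'
      exact ht (Fin.ext (by simp only; omega))
    · simp
  · refine Finset.sum_eq_zero fun t _ => if_neg ?_
    have := t.2
    omega

theorem finsum_zero_mode (b : ℤ) :
    (Function.support fun k => C.qp b k * if 2 * k + C.sig = 0 then (C.n : ℂ) / 2 else 0).Finite ∧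
    ∑ᶠ k, (C.qp b k * if 2 * k + C.sig = 0 then (C.n : ℂ) / 2 else 0) = C.eps * C.n := by
  have hs := C.hsig
  have hz : ∀ k : ℤ, k ≠ 0 →
      (C.qp b k * if 2 * k + C.sig = 0 then (C.n : ℂ) / 2 else 0) = 0 := fun k hk => by
    rw [if_neg (by omega), mul_zero]
  refine ⟨(Set.finite_singleton 0).subset fun k hk => ?_, ?_⟩
  · by_contra h
    exact hk (hz k h)
  · rw [finsum_eq_single _ 0 hz]
    unfold eps qp
    rcases hs with hs | hs
    · simp [hs]; ring
    · simp [hs]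

/-- If every density acts on `w |0⟩` with a finitely supported excess eigenvalue over the vacuum,
then `E_i(b)` acts by the weighted sum of those eigenvalues. -/
theorem Eib_smul_vac {i : ℕ} (hi : 1 ≤ i) (hi' : i ≤ C.m) (b : ℤ) (w : C.W) (μ : ℤ → ℂ)
    (hμ : (Function.support μ).Finite)
    (h : ∀ k, C.numOp i k * w = w * C.numOp i k + μ k • w) :
    C.Eib i b (w • C.vac)
      = (∑ᶠ k, C.qp b k * μ k + C.eps * (C.n : ℂ) - (C.n : ℂ) * C.om b) • (w • C.vac) := by
  have key : ∀ k, (C.qp b k • C.numOp i k) • (w • C.vac)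
      = (C.qp b k * μ k + C.qp b k * if 2 * k + C.sig = 0 then (C.n : ℂ) / 2 else 0)
        • (w • C.vac) := fun k => by
    have hcomm : ∀ z : ℂ, w • (z • C.vac) = z • (w • C.vac) := fun z => by
      rw [← algebraMap_smul C.W z C.vac, ← algebraMap_smul C.W z (w • C.vac), ← mul_smul,
        ← mul_smul, Algebra.commutes]
    rw [smul_assoc, ← mul_smul, h, add_smul, mul_smul, C.numOp_smul_vac hi hi', hcomm,
      smul_assoc, ← mul_add, mul_smul, ← add_smul, add_comm]
  have hμ' : (Function.support fun k => C.qp b k * μ k).Finite :=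
    hμ.subset fun k hk h0 => hk (by simp [h0])
  obtain ⟨hfin, hsum⟩ := C.finsum_zero_mode b
  change (∑ᶠ k : ℤ, (C.qp b k • C.numOp i k) • (w • C.vac)) - _ = _
  rw [finsum_congr key, ← finsum_smul', finsum_add_distrib hμ' hfin, hsum, ← sub_smul]
  exact (hμ'.union hfin).subset (Function.support_add _ _)

end WCtx

open WCtx in
/-- **Lemma 5.7.**  For `1 ≤ i ≤ m`, `b ∈ ℤ`, let
`E_i(b) = Σ_{r∈S} q^{-br} Σ_{c=1}^n :ψ_i^c(-r)ψ̄_i^c(r): − n ω_S(b)`.  Then for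
`1 ≤ l ≤ n`:
`E_i(b)(A_l|0⟩) = (Σ_{r∈J^S_{i,l}} q^{-br} + εn − nω_S(b)) A_l|0⟩` and
`E_i(b)(Ā_l|0⟩) = (−Σ_{r∈J̄^S_{i,n-l+1}} q^{-br} + εn − nω_S(b)) Ā_l|0⟩`. -/
theorem statement10 (C : WCtx) (i : ℕ) (hi : 1 ≤ i) (hi' : i ≤ C.m) (b : ℤ)
    (l : ℕ) (hl : 1 ≤ l) (hl' : l ≤ C.n) :
    C.Eib i b (C.Adet l • C.vac)
      = (C.Jsum i l b + C.eps * (C.n : ℂ) - (C.n : ℂ) * C.om b) • (C.Adet l • C.vac)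
    ∧ C.Eib i b (C.Abar l • C.vac)
      = (-(C.Jbarsum i (C.n - l + 1) b) + C.eps * (C.n : ℂ) - (C.n : ℂ) * C.om b)
          • (C.Abar l • C.vac) := by
  have hm : (0 : ℤ) < C.m := by have := C.hm; omega
  constructor
  · rw [C.Eib_smul_vac hi hi' b _
      (fun k => if 1 ≤ k * (C.m : ℤ) + i ∧ k * (C.m : ℤ) + i ≤ l then 1 else 0)]
    · congr 3
      unfold Jsum
      refine finsum_congr fun k => ?_
      rw [finsum_eq_if]
      simp
    · refine (Set.finite_Icc (-(i : ℤ)) l).subset fun k hk => ?_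
      have hk' : 1 ≤ k * (C.m : ℤ) + i ∧ k * (C.m : ℤ) + i ≤ l := by
        by_contra h
        exact hk (if_neg h)
      constructor <;> nlinarith
    · intro k
      rw [← sum_fin_ite_eq]
      refine C.mul_ncdet_of_commutator _ _ _ fun d t => ?_
      have := C.numOp_mul_PhiW hi hi' (d.2.trans_le hl') k (-((t : ℕ) + 1))
      rwa [neg_neg] at this
  · rw [C.Eib_smul_vac hi hi' b _
      (fun k => if 1 ≤ -(k * (C.m : ℤ)) - i + 1 ∧ -(k * (C.m : ℤ)) - i + 1 ≤ (C.n - l + 1 : ℕ)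
        then -1 else 0)]
    · congr 3
      unfold Jbarsum
      rw [← finsum_neg_distrib]
      refine finsum_congr fun k => ?_
      rw [finsum_eq_if]
      simp only [Set.mem_ofPred_eq]
      split_ifs <;> simp
    · refine (Set.finite_Icc (-(C.n - l + 1 : ℕ) - i : ℤ) 0).subset fun k hk => ?_
      have hk' : 1 ≤ -(k * (C.m : ℤ)) - i + 1 ∧
          -(k * (C.m : ℤ)) - i + 1 ≤ (C.n - l + 1 : ℕ) := by
        by_contra h
        exact hk (if_neg h)
      constructor <;> nlinarith
    · intro k
      rw [← sum_fin_ite_eq]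
      refine C.mul_ncdet_of_commutator _ _ _ fun d t => ?_
      have h := C.numOp_mul_PhibarW hi hi' (d := C.n - d) (by omega) (by omega) k
        (-((t : ℕ) + 1))
      have e : -(((t : ℕ) : ℤ) + 1) + 1 = k * C.m + i
          ↔ ((t : ℕ) : ℤ) + 1 = -(k * (C.m : ℤ)) - i + 1 := by
        constructor <;> intro h <;> linarith
      simp only [e] at h
      exact h
end
end

section
/- Let μ = (μ_1 ≥ μ_2 ≥ … ≥ μ_n) ∈ ℤ^n be weakly decreasing, let p := #{k : μ_k > 0} and s := n + 1 − #{k : μ_k < 0}, and set v_{μ,S} := A_1^{μ_1−μ_2} A_2^{μ_2−μ_3} ⋯ A_{p−1}^{μ_{p−1}−μ_p} A_p^{μ_p} · Abar_s^{−μ_s} Abar_{s+1}^{μ_s−μ_{s+1}} ⋯ Abar_n^{μ_{n−1}−μ_n} |0⟩ ∈ F_N(S) (empty products omitted when p = 0 or s = n+1). Then v_{μ,S} is nonzero and: (a) ( Σ_{r∈S} q^{−br} Σ_{k=1}^{n} :psi_i^k(a−r) psibar_j^k(r): ) v_{μ,S} = 0 for all 1 ≤ i, j ≤ m and a, b ∈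 ℤ with a > 0, or a = 0 and i < j; (b) E_i(b) v_{μ,S} = η_{μ,S}(i,b) v_{μ,S} for all 1 ≤ i ≤ m and b ∈ ℤ, where E_i(b) := Σ_{r∈S} q^{−br} Σ_{k=1}^{n} :psi_i^k(−r) psibar_i^k(r): − nω_S(b)·Id; (c) ( Σ_{k=1}^{m} Σ_{r∈S} :psi_k^p'(−r) psibar_k^{p'+1}(r): ) v_{μ,S} = 0 for all 1 ≤ p' ≤ n−1; (d) E_{p',p'} v_{μ,S} = μ_{p'} v_{μ,S} for all 1 ≤ p' ≤ n, where E_{p',p'} := Σ_{k=1}^{m} Σ_{r∈S} :psi_k^{p'}(−r) psibar_k^{p'}(r): − εm·Id. That is, v_{μ,S} is a joint highest weight vector for the dual pair (GL_n, glhat_m(C_q)) on F_N(S) with highest weight (μ, η_{μ,S}). -/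
noncomputable section

namespace WCtx

variable (C : WCtx)

/-- The joint highest weight vector
`v_{μ,S} = A_1^{μ_1-μ_2} ⋯ A_{p-1}^{μ_{p-1}-μ_p} A_p^{μ_p} Ā_s^{-μ_s} Ā_{s+1}^{μ_s-μ_{s+1}} ⋯ Ā_n^{μ_{n-1}-μ_n} |0⟩`. -/
def vGL (μ : ℕ → ℤ) (p s : ℕ) : C.F :=
  ((((List.range p).map fun idx =>
        C.Adet (idx + 1) ^
          (if idx + 1 < p then (μ (idx + 1) - μ (idx + 2)).toNat else (μ p).toNat)).prod) *
    (((List.range (C.n + 1 - s)).map fun idx =>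
        C.Abar (s + idx) ^
          (if idx = 0 then (-(μ s)).toNat
           else (μ (s + idx - 1) - μ (s + idx)).toNat)).prod)) • C.vac

/-- The highest weight `η_{μ,S}(i,b)` for the pair `(GL_n, ĝl_m(C_q))`. -/
def etaGL (μ : ℕ → ℤ) (p s : ℕ) (i : ℕ) (b : ℤ) : ℂ :=
  (∑ k ∈ Finset.Ico 1 p, ((μ k - μ (k + 1) : ℤ) : ℂ) * C.Jsum i k b)
    + (if 1 ≤ p then ((μ p : ℤ) : ℂ) * C.Jsum i p b else 0)
    + (if s ≤ C.n then ((μ s : ℤ) : ℂ) * C.Jbarsum i (C.n - s + 1) b else 0)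
    - (∑ k ∈ Finset.Icc (s + 1) C.n, ((μ (k - 1) - μ k : ℤ) : ℂ) * C.Jbarsum i (C.n - k + 1) b)
    + C.eps * (C.n : ℂ) - (C.n : ℂ) * C.om b

end WCtx

namespace DetVector

open MvPolynomial

section Derivations

variable {R : Type*} [CommRing R] [Algebra ℂ R]

lemma derivation_prod_eq_zero {ι : Type*} (D : Derivation ℂ R R) (t : Finset ι) (f : ι → R)
    (h : ∀ i ∈ t, D (f i) = 0) : D (∏ i ∈ t, f i) = 0 := by
  classical
  induction t using Finset.induction_on with
  | empty => simp
  | insert a t ha ih =>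
    rw [Finset.prod_insert ha, D.leibniz, h a (by simp), ih fun i hi => h i (by simp [hi])]
    simp

lemma derivation_det_of_forall_eq_zero {l : ℕ} (D : Derivation ℂ R R)
    (M : Matrix (Fin l) (Fin l) R) (h : ∀ i j, D (M i j) = 0) : D M.det = 0 := by
  rw [Matrix.det_apply, map_sum]
  refine Finset.sum_eq_zero fun σ _ => ?_
  rw [Units.smul_def, map_zsmul, derivation_prod_eq_zero D _ _ fun i _ => h _ _, smul_zero]

lemma derivation_det_of_col {l : ℕ} (D : Derivation ℂ R R) (M : Matrix (Fin l) (Fin l) R)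
    (s : Fin l) (w : Fin l → R) (h : ∀ i j, D (M i j) = if j = s then w i else 0) :
    D M.det = (M.updateCol s w).det := by
  rw [Matrix.det_apply, map_sum, Matrix.det_apply]
  refine Finset.sum_congr rfl fun σ _ => ?_
  rw [Units.smul_def, map_zsmul, Units.smul_def,
    ← Finset.mul_prod_erase _ (fun i => M (σ i) i) (Finset.mem_univ s),
    ← Finset.mul_prod_erase _ (fun i => M.updateCol s w (σ i) i) (Finset.mem_univ s),
    D.leibniz, derivation_prod_eq_zero D _ _ fun i hi => by
      rw [h, if_neg (Finset.ne_of_mem_erase hi)], h, if_pos rfl, smul_zero, zero_add, smul_eq_mul,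
    mul_comm, Matrix.updateCol_self]
  congr 2
  refine Finset.prod_congr rfl fun i hi => ?_
  rw [Matrix.updateCol_ne (Finset.ne_of_mem_erase hi)]

lemma derivation_det_of_row {l : ℕ} (D : Derivation ℂ R R) (M : Matrix (Fin l) (Fin l) R)
    (s : Fin l) (w : Fin l → R) (h : ∀ i j, D (M i j) = if i = s then w j else 0) :
    D M.det = (M.updateRow s w).det := by
  rw [← Matrix.det_transpose, derivation_det_of_col D M.transpose s w fun i j => h j i,
    Matrix.updateCol_transpose, Matrix.det_transpose]

lemma derivation_mul_eigen (D : Derivation ℂ R R) {f g : R} {a b : ℂ} (hf : D f = a • f)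
    (hg : D g = b • g) : D (f * g) = (a + b) • (f * g) := by
  rw [D.leibniz, hf, hg, smul_eq_mul, smul_eq_mul, mul_smul_comm, mul_smul_comm, add_smul,
    mul_comm g f, add_comm]

lemma derivation_pow_eigen (D : Derivation ℂ R R) {f : R} {a : ℂ} (hf : D f = a • f) (e : ℕ) :
    D (f ^ e) = (e * a) • f ^ e := by
  induction e with
  | zero => simp
  | succ e ih =>
    rw [pow_succ, derivation_mul_eigen D ih hf]
    push_cast
    ring_nf

lemma derivation_prod_pow_eigen (D : Derivation ℂ R R) (N : ℕ) (f : ℕ → R) (e : ℕ → ℕ)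
    (a : ℕ → ℂ) (hf : ∀ i < N, D (f i) = a i • f i) :
    D (∏ i ∈ Finset.range N, f i ^ e i)
      = (∑ i ∈ Finset.range N, e i * a i) • ∏ i ∈ Finset.range N, f i ^ e i := by
  induction N with
  | zero => simp
  | succ N ih =>
    rw [Finset.prod_range_succ, Finset.sum_range_succ]
    exact derivation_mul_eigen D (ih fun i hi => hf i (by omega))
      (derivation_pow_eigen D (hf N (by omega)) _)

end Derivations

variable {n : ℕ}

/-- The variables of the polynomial model of the Fock space. -/
abbrev Var (n : ℕ) : Type := Bool × Fin n × ℕ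

/-- The column operation `∑_c x_{c,t} ∂/∂x_{c,s}` on the variables of kind `b`. -/
def colOp (b : Bool) (t s : ℕ) :
    Derivation ℂ (MvPolynomial (Var n) ℂ) (MvPolynomial (Var n) ℂ) :=
  ∑ c : Fin n, (X (b, c, t) : MvPolynomial (Var n) ℂ) • pderiv (b, c, s)

/-- The row operation `∑_t x_{c,t} ∂/∂x_{d,t}` on the variables of kind `b`. -/
def rowOp (b : Bool) (c d : Fin n) (T : ℕ) :
    Derivation ℂ (MvPolynomial (Var n) ℂ) (MvPolynomial (Var n) ℂ) :=
  ∑ t ∈ Finset.range T, (X (b, c, t) : MvPolynomial (Var n) ℂ) • pderiv (b, d, t)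

lemma colOp_apply (b : Bool) (t s : ℕ) (f : MvPolynomial (Var n) ℂ) :
    colOp b t s f = ∑ c : Fin n, X (b, c, t) * pderiv (b, c, s) f := by
  have h := map_sum (Derivation.coeFnAddMonoidHom (R := ℂ) (A := MvPolynomial (Var n) ℂ)
    (M := MvPolynomial (Var n) ℂ)) (fun c : Fin n =>
      (X (b, c, t) : MvPolynomial (Var n) ℂ) • pderiv (b, c, s)) Finset.univ
  exact (congrFun h f).trans (by simp)

lemma rowOp_apply (b : Bool) (c d : Fin n) (T : ℕ) (f : MvPolynomial (Var n) ℂ) :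
    rowOp b c d T f = ∑ t ∈ Finset.range T, X (b, c, t) * pderiv (b, d, t) f := by
  have h := map_sum (Derivation.coeFnAddMonoidHom (R := ℂ) (A := MvPolynomial (Var n) ℂ)
    (M := MvPolynomial (Var n) ℂ)) (fun t : ℕ =>
      (X (b, c, t) : MvPolynomial (Var n) ℂ) • pderiv (b, d, t)) (Finset.range T)
  exact (congrFun h f).trans (by simp)

lemma colOp_X (b b' : Bool) (t s u : ℕ) (c : Fin n) :
    colOp b t s (X (b', c, u)) = if b = b' ∧ u = s then X (b, c, t) else 0 := by
  rw [colOp_apply]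
  simp only [pderiv_X, Pi.single_apply, Prod.mk.injEq, mul_ite, mul_one, mul_zero]
  by_cases h : b = b' ∧ u = s
  · simp [h.1, h.2]
  · rw [if_neg h]
    exact Finset.sum_eq_zero fun x _ => if_neg fun hx => h ⟨hx.1.symm, hx.2.2⟩

lemma rowOp_X (b b' : Bool) (c d e : Fin n) {T u : ℕ} (hu : u < T) :
    rowOp b c d T (X (b', e, u)) = if b = b' ∧ e = d then X (b, c, u) else 0 := by
  rw [rowOp_apply]
  simp only [pderiv_X, Pi.single_apply, Prod.mk.injEq, mul_ite, mul_one, mul_zero]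
  by_cases h : b = b' ∧ e = d
  · simp [h.1, h.2, hu]
  · rw [if_neg h]
    exact Finset.sum_eq_zero fun x _ => if_neg fun hx => h ⟨hx.1.symm, hx.2.1⟩

/-- The `l × l` determinant in the variables of kind `b` with rows `r 0, …, r (l - 1)`. -/
def varDet (b : Bool) (r : ℕ → Fin n) (l : ℕ) : MvPolynomial (Var n) ℂ :=
  Matrix.det (Matrix.of fun k t : Fin l => (X (b, r k, (t : ℕ)) : MvPolynomial (Var n) ℂ))

lemma varDet_ne_zero (b : Bool) (r : ℕ → Fin n) (l : ℕ) (hr : Set.InjOn r (Set.Iio l)) :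
    varDet b r l ≠ 0 := by
  have hinj : Function.Injective fun x : Fin l × Fin l => ((b, r x.1, (x.2 : ℕ)) : Var n) := by
    rintro ⟨i, j⟩ ⟨i', j'⟩ h
    simp only [Prod.mk.injEq, true_and] at h
    exact Prod.ext (Fin.ext (hr i.2 i'.2 h.1)) (Fin.ext h.2)
  have h : varDet b r l = rename (fun x : Fin l × Fin l => ((b, r x.1, (x.2 : ℕ)) : Var n))
      (Matrix.det (Matrix.mvPolynomialX (Fin l) (Fin l) ℂ)) := by
    rw [AlgHom.map_det, varDet]
    congr 1
    ext1 i j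
    simp [Matrix.mvPolynomialX]
  rw [h, Ne, map_eq_zero_iff _ (rename_injective _ hinj)]
  exact Matrix.det_mvPolynomialX_ne_zero _ _

lemma pderiv_varDet_eq_zero (b b' : Bool) (r : ℕ → Fin n) (l : ℕ) (c : Fin n) (t : ℕ)
    (h : b = b' → ∀ k < l, r k ≠ c) : pderiv (b, c, t) (varDet b' r l) = 0 := by
  refine derivation_det_of_forall_eq_zero _ _ fun i j => ?_
  rw [Matrix.of_apply, pderiv_X, Pi.single_apply, if_neg]
  simp only [Prod.mk.injEq, not_and]
  exact fun h1 h2 => absurd h2 (h h1.symm i i.2)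

lemma colOp_varDet_of_lt (b b' : Bool) (r : ℕ → Fin n) (l : ℕ) {t s : ℕ} (hts : t < s) :
    colOp b t s (varDet b' r l) = 0 := by
  by_cases h : b = b' ∧ s < l
  · obtain ⟨rfl, hs⟩ := h
    rw [varDet, derivation_det_of_col _ _ ⟨s, hs⟩ (fun k => X (b, r k, t))]
    · refine Matrix.det_zero_of_column_eq (i := ⟨t, hts.trans hs⟩) (j := ⟨s, hs⟩)
        (by simp [hts.ne]) fun k => ?_
      rw [Matrix.updateCol_self, Matrix.updateCol_ne (by simp [hts.ne])]
      rfl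
    · intro i j
      simp [colOp_X, Fin.ext_iff]
  · refine derivation_det_of_forall_eq_zero _ _ fun i j => ?_
    rw [Matrix.of_apply, colOp_X, if_neg]
    rintro ⟨rfl, rfl⟩
    exact h ⟨rfl, j.2⟩

lemma colOp_varDet_self (b b' : Bool) (r : ℕ → Fin n) (l s : ℕ) :
    colOp b s s (varDet b' r l) = (if b = b' ∧ s < l then (1 : ℂ) else 0) • varDet b' r l := by
  by_cases h : b = b' ∧ s < l
  · rw [if_pos h, one_smul]
    obtain ⟨rfl, hs⟩ := h
    rw [varDet, derivation_det_of_col _ _ ⟨s, hs⟩ (fun k => X (b, r k, s))]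
    · congr 1
      exact Matrix.updateCol_eq_self _ (⟨s, hs⟩ : Fin l)
    · intro i j
      simp [colOp_X, Fin.ext_iff]
  · rw [if_neg h, zero_smul]
    refine derivation_det_of_forall_eq_zero _ _ fun i j => ?_
    rw [Matrix.of_apply, colOp_X, if_neg]
    rintro ⟨rfl, rfl⟩
    exact h ⟨rfl, j.2⟩

lemma rowOp_varDet_of_not_mem (b b' : Bool) (r : ℕ → Fin n) {l T : ℕ} (hT : l ≤ T) (c d : Fin n)
    (h : ¬ (b = b' ∧ ∃ k < l, r k = d)) : rowOp b c d T (varDet b' r l) = 0 := by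
  refine derivation_det_of_forall_eq_zero _ _ fun i j => ?_
  rw [Matrix.of_apply, rowOp_X _ _ _ _ _ (j.2.trans_le hT), if_neg]
  rintro ⟨rfl, h2⟩
  exact h ⟨rfl, i, i.2, h2⟩

lemma rowOp_varDet_of_mem (b : Bool) (r : ℕ → Fin n) {l T : ℕ} (hT : l ≤ T) (c : Fin n)
    (hr : Set.InjOn r (Set.Iio l)) {k : ℕ} (hk : k < l) :
    rowOp b c (r k) T (varDet b r l)
      = ((Matrix.of fun k t : Fin l => (X (b, r k, (t : ℕ)) : MvPolynomial (Var n) ℂ)).updateRow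
          ⟨k, hk⟩ fun t => X (b, c, (t : ℕ))).det := by
  rw [varDet, derivation_det_of_row _ _ ⟨k, hk⟩ (fun t => X (b, c, (t : ℕ)))]
  intro i j
  rw [Matrix.of_apply, rowOp_X _ _ _ _ _ (j.2.trans_le hT)]
  refine if_congr ?_ rfl rfl
  have h : i = ⟨k, hk⟩ ↔ (i : ℕ) = k := Fin.ext_iff
  rw [eq_self_iff_true, true_and, h]
  exact hr.eq_iff i.2 hk

lemma rowOp_varDet_of_ne (b b' : Bool) (r : ℕ → Fin n) {l T : ℕ} (hT : l ≤ T) {c d : Fin n}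
    (hr : Set.InjOn r (Set.Iio l)) (hcd : c ≠ d)
    (h : b = b' → (∃ k < l, r k = d) → ∃ k < l, r k = c) : rowOp b c d T (varDet b' r l) = 0 := by
  by_cases h0 : b = b' ∧ ∃ k < l, r k = d
  · obtain ⟨rfl, k, hk, rfl⟩ := h0
    obtain ⟨k', hk', rfl⟩ := h rfl ⟨k, hk, rfl⟩
    have hne : k' ≠ k := fun h => hcd (h ▸ rfl)
    rw [rowOp_varDet_of_mem b r hT _ hr hk]
    refine Matrix.det_zero_of_row_eq (i := ⟨k', hk'⟩) (j := ⟨k, hk⟩) (by simp [hne]) ?_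
    rw [Matrix.updateRow_self, Matrix.updateRow_ne (by simp [hne])]
    rfl
  · exact rowOp_varDet_of_not_mem b b' r hT c d h0

open scoped Classical in
lemma rowOp_varDet_self (b b' : Bool) (r : ℕ → Fin n) {l T : ℕ} (hT : l ≤ T) (c : Fin n)
    (hr : Set.InjOn r (Set.Iio l)) :
    rowOp b c c T (varDet b' r l)
      = (if b = b' ∧ ∃ k < l, r k = c then (1 : ℂ) else 0) • varDet b' r l := by
  by_cases h : b = b' ∧ ∃ k < l, r k = c
  · rw [if_pos h, one_smul]
    obtain ⟨rfl, k, hk, rfl⟩ := h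
    rw [rowOp_varDet_of_mem b r hT _ hr hk, varDet]
    congr 1
    exact Matrix.updateRow_eq_self _ (⟨k, hk⟩ : Fin l)
  · rw [if_neg h, zero_smul]
    exact rowOp_varDet_of_not_mem b b' r hT c c h

/-- The order `0, 1, …, n - 1` of the rows. -/
def rowsUp (hn : 0 < n) (k : ℕ) : Fin n := ⟨k % n, Nat.mod_lt _ hn⟩

/-- The order `n - 1, …, 1, 0` of the rows. -/
def rowsDown (hn : 0 < n) (k : ℕ) : Fin n := ⟨n - 1 - k, by omega⟩

lemma rowsUp_injOn (hn : 0 < n) {l : ℕ} (hl : l ≤ n) : Set.InjOn (rowsUp hn) (Set.Iio l) := by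
  intro i hi j hj h
  simp only [Set.mem_Iio] at hi hj
  simpa [rowsUp, Fin.ext_iff, Nat.mod_eq_of_lt (hi.trans_le hl),
    Nat.mod_eq_of_lt (hj.trans_le hl)] using h

lemma rowsDown_injOn (hn : 0 < n) {l : ℕ} (hl : l ≤ n) :
    Set.InjOn (rowsDown hn) (Set.Iio l) := by
  intro i hi j hj h
  simp only [Set.mem_Iio, rowsDown, Fin.mk.injEq] at hi hj h
  omega

lemma exists_rowsUp_iff (hn : 0 < n) (l : ℕ) (c : Fin n) :
    (∃ k < l, rowsUp hn k = c) ↔ (c : ℕ) < l := by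
  constructor
  · rintro ⟨k, hk, rfl⟩
    exact (Nat.mod_le _ _).trans_lt hk
  · exact fun h => ⟨c, h, Fin.ext (Nat.mod_eq_of_lt c.2)⟩

lemma exists_rowsDown_iff (hn : 0 < n) {l : ℕ} (hl : l ≤ n) (c : Fin n) :
    (∃ k < l, rowsDown hn k = c) ↔ n ≤ (c : ℕ) + l := by
  constructor
  · rintro ⟨k, hk, rfl⟩
    simp only [rowsDown]
    omega
  · exact fun h => ⟨n - 1 - c, by omega, Fin.ext (by simp only [rowsDown]; omega)⟩

/-- The product of powers of determinants representing the highest weight vector. -/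
def detVec (hn : 0 < n) (p s : ℕ) (eA eB : ℕ → ℕ) : MvPolynomial (Var n) ℂ :=
  (∏ i ∈ Finset.range p, varDet false (rowsUp hn) (i + 1) ^ eA i) *
    ∏ i ∈ Finset.range (n + 1 - s), varDet true (rowsDown hn) (n - (s + i) + 1) ^ eB i

section DetVec

variable (hn : 0 < n) {p s : ℕ} (eA eB : ℕ → ℕ)

lemma detVec_ne_zero (hp : p < s) (hs : s ≤ n + 1) : detVec hn p s eA eB ≠ 0 := by
  refine mul_ne_zero (Finset.prod_ne_zero_iff.2 fun i hi => pow_ne_zero _ ?_)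
    (Finset.prod_ne_zero_iff.2 fun i hi => pow_ne_zero _ ?_) <;> rw [Finset.mem_range] at hi
  · exact varDet_ne_zero _ _ _ (rowsUp_injOn hn (by omega))
  · exact varDet_ne_zero _ _ _ (rowsDown_injOn hn (by omega))

lemma derivation_detVec (D : Derivation ℂ (MvPolynomial (Var n) ℂ) (MvPolynomial (Var n) ℂ))
    (α β : ℕ → ℂ)
    (hα : ∀ i < p, D (varDet false (rowsUp hn) (i + 1))
      = α i • varDet false (rowsUp hn) (i + 1))
    (hβ : ∀ i < n + 1 - s, D (varDet true (rowsDown hn) (n - (s + i) + 1))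
      = β i • varDet true (rowsDown hn) (n - (s + i) + 1)) :
    D (detVec hn p s eA eB)
      = (∑ i ∈ Finset.range p, eA i * α i + ∑ i ∈ Finset.range (n + 1 - s), eB i * β i) •
        detVec hn p s eA eB :=
  derivation_mul_eigen D (derivation_prod_pow_eigen D _ _ _ _ hα)
    (derivation_prod_pow_eigen D _ _ _ _ hβ)

lemma derivation_detVec_eq_zero
    (D : Derivation ℂ (MvPolynomial (Var n) ℂ) (MvPolynomial (Var n) ℂ))
    (hα : ∀ i < p, D (varDet false (rowsUp hn) (i + 1)) = 0)
    (hβ : ∀ i < n + 1 - s, D (varDet true (rowsDown hn) (n - (s + i) + 1)) = 0) :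
    D (detVec hn p s eA eB) = 0 := by
  rw [derivation_detVec hn eA eB D 0 0 (by simpa using hα) (by simpa using hβ)]
  simp

lemma colOp_detVec_of_lt (b : Bool) {t u : ℕ} (h : t < u) :
    colOp b t u (detVec hn p s eA eB) = 0 :=
  derivation_detVec_eq_zero hn eA eB _ (fun _ _ => colOp_varDet_of_lt _ _ _ _ h)
    fun _ _ => colOp_varDet_of_lt _ _ _ _ h

lemma colOp_false_detVec (u : ℕ) :
    colOp false u u (detVec hn p s eA eB)
      = (∑ i ∈ Finset.range p, (eA i : ℂ) * if u < i + 1 then 1 else 0) •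
        detVec hn p s eA eB := by
  rw [derivation_detVec hn eA eB _ _ _ (fun _ _ => colOp_varDet_self _ _ _ _ _)
    fun _ _ => colOp_varDet_self _ _ _ _ _]
  simp

lemma colOp_true_detVec (u : ℕ) :
    colOp true u u (detVec hn p s eA eB)
      = (∑ i ∈ Finset.range (n + 1 - s), (eB i : ℂ) * if u < n - (s + i) + 1 then 1 else 0) •
        detVec hn p s eA eB := by
  rw [derivation_detVec hn eA eB _ _ _ (fun _ _ => colOp_varDet_self _ _ _ _ _)
    fun _ _ => colOp_varDet_self _ _ _ _ _]
  simp

lemma pderiv_false_detVec (c : Fin n) (t : ℕ) (hc : p ≤ c) :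
    pderiv (false, c, t) (detVec hn p s eA eB) = 0 := by
  refine derivation_detVec_eq_zero hn eA eB _ (fun i hi => pderiv_varDet_eq_zero _ _ _ _ _ _ ?_)
    fun i hi => pderiv_varDet_eq_zero _ _ _ _ _ _ (by simp)
  have h := exists_rowsUp_iff hn (i + 1) c
  intro _ k hk hkc
  have := h.1 ⟨k, hk, hkc⟩
  omega

lemma pderiv_true_detVec (hs : s ≤ n + 1) (c : Fin n) (t : ℕ) (hc : (c : ℕ) + 1 < s) :
    pderiv (true, c, t) (detVec hn p s eA eB) = 0 := by
  refine derivation_detVec_eq_zero hn eA eB _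
    (fun i hi => pderiv_varDet_eq_zero _ _ _ _ _ _ (by simp))
    fun i hi => pderiv_varDet_eq_zero _ _ _ _ _ _ ?_
  have h := exists_rowsDown_iff hn (l := n - (s + i) + 1) (by omega) c
  intro _ k hk hkc
  have := h.1 ⟨k, hk, hkc⟩
  omega

lemma rowOp_false_detVec_of_lt (hp : p < s) (hs : s ≤ n + 1) {c d : Fin n} (hcd : c < d) {T : ℕ}
    (hT : n ≤ T) :
    rowOp false c d T (detVec hn p s eA eB) = 0 := by
  refine derivation_detVec_eq_zero hn eA eB _
    (fun i hi => rowOp_varDet_of_ne _ _ _ (by omega) (rowsUp_injOn hn (by omega)) hcd.ne ?_)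
    fun i hi => rowOp_varDet_of_ne _ _ _ (by omega) (rowsDown_injOn hn (by omega)) hcd.ne
      (by simp)
  rw [exists_rowsUp_iff, exists_rowsUp_iff]
  exact fun _ h => lt_trans hcd h

lemma rowOp_true_detVec_of_lt (hp : p < s) (hs : s ≤ n + 1) {c d : Fin n} (hcd : d < c) {T : ℕ}
    (hT : n ≤ T) :
    rowOp true c d T (detVec hn p s eA eB) = 0 := by
  refine derivation_detVec_eq_zero hn eA eB _
    (fun i hi => rowOp_varDet_of_ne _ _ _ (by omega) (rowsUp_injOn hn (by omega)) hcd.ne'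
      (by simp))
    fun i hi => rowOp_varDet_of_ne _ _ _ (by omega) (rowsDown_injOn hn (by omega)) hcd.ne' ?_
  rw [exists_rowsDown_iff hn (by omega), exists_rowsDown_iff hn (by omega)]
  have : (d : ℕ) < c := hcd
  omega

lemma rowOp_false_detVec_self (hp : p < s) (hs : s ≤ n + 1) (c : Fin n) {T : ℕ} (hT : n ≤ T) :
    rowOp false c c T (detVec hn p s eA eB)
      = (∑ i ∈ Finset.range p, (eA i : ℂ) * if (c : ℕ) < i + 1 then 1 else 0) •
        detVec hn p s eA eB := by
  rw [derivation_detVec hn eA eB _ (fun i => if (c : ℕ) < i + 1 then 1 else 0) 0]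
  · simp
  · intro i hi
    rw [rowOp_varDet_self _ _ _ (by omega) _ (rowsUp_injOn hn (by omega))]
    simp only [exists_rowsUp_iff, true_and]
  · intro i hi
    rw [rowOp_varDet_self _ _ _ (by omega) _ (rowsDown_injOn hn (by omega))]
    simp

lemma rowOp_true_detVec_self (hp : p < s) (hs : s ≤ n + 1) (c : Fin n) {T : ℕ} (hT : n ≤ T) :
    rowOp true c c T (detVec hn p s eA eB)
      = (∑ i ∈ Finset.range (n + 1 - s), (eB i : ℂ) * if s + i ≤ (c : ℕ) + 1 then 1 else 0) •
        detVec hn p s eA eB := by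
  rw [derivation_detVec hn eA eB _ 0 (fun i => if s + i ≤ (c : ℕ) + 1 then 1 else 0)]
  · simp
  · intro i hi
    rw [rowOp_varDet_self _ _ _ (by omega) _ (rowsUp_injOn hn (by omega))]
    simp
  · intro i hi
    rw [rowOp_varDet_self _ _ _ (by omega) _ (rowsDown_injOn hn (by omega))]
    simp only [exists_rowsDown_iff hn (show n - (s + i) + 1 ≤ n by omega), true_and]
    congr 1
    exact if_congr (by omega) rfl rfl

end DetVec

end DetVector

namespace WCtx

open MvPolynomial DetVector

variable (C : WCtx)

instance inst_s11 : IsScalarTower ℂ C.W C.F :=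
  inferInstanceAs (IsScalarTower ℂ C.W (C.W ⧸ C.vacIdeal))

lemma psi0_comm (i j : Fin C.NN) (k l : ℤ) :
    C.psi0 i k * C.psi0 j l = C.psi0 j l * C.psi0 i k := by
  have h := RingQuot.mkAlgHom_rel ℂ (rel.comm_psi (C := C) i j k l)
  rw [map_mul, map_mul] at h
  exact h

lemma psibar0_comm (i j : Fin C.NN) (k l : ℤ) :
    C.psibar0 i k * C.psibar0 j l = C.psibar0 j l * C.psibar0 i k := by
  have h := RingQuot.mkAlgHom_rel ℂ (rel.comm_psibar (C := C) i j k l)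
  rw [map_mul, map_mul] at h
  exact h

lemma psibar0_mul_psi0 (i j : Fin C.NN) (k l : ℤ) :
    C.psibar0 i k * C.psi0 j l
      = C.psi0 j l * C.psibar0 i k + if i = j ∧ k + l + C.sig = 0 then 1 else 0 := by
  have h := RingQuot.mkAlgHom_rel ℂ (rel.mixed (C := C) i j k l)
  rw [map_add, map_mul, map_mul] at h
  refine h.trans ?_
  split_ifs <;> simp [psi0, psibar0] <;> rfl

lemma psi0_smul_vac (i : Fin C.NN) {k : ℤ} (hk : 0 < k + C.sig) : C.psi0 i k • C.vac = 0 := by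
  refine (Submodule.Quotient.mk_eq_zero _).2 (Submodule.subset_span ?_)
  refine Or.inl ⟨i, k, ?_, Or.inl (mul_one _)⟩
  have := C.hsig
  omega

lemma psibar0_smul_vac (i : Fin C.NN) {k : ℤ} (hk : 0 ≤ k) : C.psibar0 i k • C.vac = 0 := by
  refine (Submodule.Quotient.mk_eq_zero _).2 (Submodule.subset_span ?_)
  by_cases h : 0 < 2 * k + C.sig
  · exact Or.inl ⟨i, k, h, Or.inr (mul_one _)⟩
  · have := C.hsig
    obtain rfl : k = 0 := by omega
    exact Or.inr ⟨by omega, i, mul_one _⟩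

lemma m_pos : (0 : ℤ) < C.m := by exact_mod_cast C.hm

/-- The flat index (starting at `0`) with residue `t mod m` in the block `c`. -/
def flat (c : Fin C.n) (t : ℤ) : Fin C.NN :=
  ⟨(t.emod C.m).toNat + c * C.m, by
    have h0 := C.hm
    have h1 := Int.emod_lt_of_pos t C.m_pos
    have h2 : (c + 1) * C.m ≤ C.n * C.m := Nat.mul_le_mul_right _ c.2
    have h3 : (t % C.m).toNat < C.m := by omega
    change (t % C.m).toNat + c * C.m < C.m * C.n
    nlinarith⟩

lemma flat_eq_flat_iff (c d : Fin C.n) (t u : ℤ) :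
    C.flat c t = C.flat d u ↔ c = d ∧ t % C.m = u % C.m := by
  have h1 := Int.emod_lt_of_pos t C.m_pos
  have h2 := Int.emod_lt_of_pos u C.m_pos
  have h3 := Int.emod_nonneg t C.m_pos.ne'
  have h4 := Int.emod_nonneg u C.m_pos.ne'
  constructor
  · intro h
    have h : (t % C.m).toNat + c * C.m = (u % C.m).toNat + d * C.m := congrArg Fin.val h
    have hm := C.hm
    have hc := congrArg (· / C.m) h
    have hr := congrArg (· % C.m) h
    simp only [Nat.add_mul_div_right _ _ hm, Nat.add_mul_mod_self_right] at hc hr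
    rw [Nat.div_eq_of_lt (by omega), Nat.div_eq_of_lt (by omega)] at hc
    rw [Nat.mod_eq_of_lt (by omega), Nat.mod_eq_of_lt (by omega)] at hr
    exact ⟨Fin.ext (by omega), by omega⟩
  · rintro ⟨rfl, h⟩
    exact Fin.ext (by change (t % C.m).toNat + _ = (u % C.m).toNat + _; rw [h])

/-- `φ^{c+1}_{t + sig/2}` for a superscript in `Fin n`. -/
def phi (c : Fin C.n) (t : ℤ) : C.W := C.psi0 (C.flat c (-t - 1)) (-((-t - 1) / C.m) - C.sig)

/-- `φ̄^{c+1}_{t + sig/2}` for a superscript in `Fin n`. -/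
def phibar (c : Fin C.n) (t : ℤ) : C.W := C.psibar0 (C.flat c t) (t / C.m)

lemma PhibarW_eq (c : Fin C.n) (t : ℤ) : C.PhibarW (c + 1) t = C.phibar c t := by
  have h := (C.flat c t).2
  simp only [flat] at h
  rw [PhibarW, psibarF, dif_pos (by rw [Nat.add_sub_cancel]; omega), phibar]
  congr 1
  · exact Fin.ext (by simp only [flat, Nat.add_sub_cancel]; omega)
  · change (t - t % C.m) / C.m = t / C.m
    exact Int.ediv_eq_of_eq_mul_right C.m_pos.ne' (by linarith [Int.mul_ediv_add_emod t C.m])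

lemma PhiW_eq (c : Fin C.n) (t : ℤ) : C.PhiW (c + 1) t = C.phi c t := by
  have h := (C.flat c (-t - 1)).2
  simp only [flat] at h
  rw [PhiW, psiF, dif_pos (by rw [Nat.add_sub_cancel]; omega), phi]
  congr 1
  · exact Fin.ext (by simp only [flat, Nat.add_sub_cancel]; omega)
  · change (t + (-t - 1) % C.m + 1) / C.m - C.sig = _
    congr 1
    exact Int.ediv_eq_of_eq_mul_right C.m_pos.ne' (by linarith [Int.mul_ediv_add_emod (-t - 1) C.m])

lemma psibarS_eq (c : Fin C.n) {j : ℕ} (hj : 1 ≤ j) (hjm : j ≤ C.m) (k : ℤ) :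
    C.psibarS j (c + 1) k = C.phibar c (k * C.m + (j - 1)) := by
  have h1 : (k * C.m + ((j : ℤ) - 1)) % C.m = j - 1 := by
    rw [add_comm, Int.add_mul_emod_self_right, Int.emod_eq_of_lt (by omega) (by omega)]
  have h2 : (k * C.m + ((j : ℤ) - 1)) / C.m = k := by
    rw [add_comm, Int.add_mul_ediv_right _ _ C.m_pos.ne',
      Int.ediv_eq_zero_of_lt (by omega) (by omega), zero_add]
  have h := (C.flat c (k * C.m + (j - 1))).2
  have h3 : (C.flat c (k * C.m + (j - 1)) : ℕ) = j - 1 + c * C.m := by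
    change ((k * C.m + ((j : ℤ) - 1)) % C.m).toNat + _ = _
    rw [h1]
    omega
  rw [h3] at h
  rw [psibarS, psibarF, dif_pos (by simp only [Nat.add_sub_cancel]; omega), phibar, h2]
  congr 1
  exact Fin.ext (by rw [h3]; simp only [Nat.add_sub_cancel]; omega)

lemma psiS_eq (c : Fin C.n) {i : ℕ} (hi : 1 ≤ i) (him : i ≤ C.m) (k : ℤ) :
    C.psiS i (c + 1) (k - C.sig) = C.phi c (k * C.m - i) := by
  have h0 : -(k * C.m - (i : ℤ)) - 1 = (i - 1) + (-k) * C.m := by ring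
  have h1 : (-(k * C.m - (i : ℤ)) - 1) % C.m = i - 1 := by
    rw [h0, Int.add_mul_emod_self_right, Int.emod_eq_of_lt (by omega) (by omega)]
  have h2 : (-(k * C.m - (i : ℤ)) - 1) / C.m = -k := by
    rw [h0, Int.add_mul_ediv_right _ _ C.m_pos.ne',
      Int.ediv_eq_zero_of_lt (by omega) (by omega), zero_add]
  have h := (C.flat c (-(k * C.m - (i : ℤ)) - 1)).2
  have h3 : (C.flat c (-(k * C.m - (i : ℤ)) - 1) : ℕ) = i - 1 + c * C.m := by
    change ((-(k * C.m - (i : ℤ)) - 1) % C.m).toNat + _ = _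
    rw [h1]
    omega
  rw [h3] at h
  rw [psiS, psiF, dif_pos (by simp only [Nat.add_sub_cancel]; omega), phi, h2, neg_neg]
  congr 1
  exact Fin.ext (by rw [h3]; simp only [Nat.add_sub_cancel]; omega)

lemma phi_comm (c d : Fin C.n) (t u : ℤ) : C.phi c t * C.phi d u = C.phi d u * C.phi c t :=
  C.psi0_comm _ _ _ _

lemma phibar_comm (c d : Fin C.n) (t u : ℤ) :
    C.phibar c t * C.phibar d u = C.phibar d u * C.phibar c t :=
  C.psibar0_comm _ _ _ _

lemma phibar_mul_phi (c d : Fin C.n) (s t : ℤ) :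
    C.phibar c s * C.phi d t
      = C.phi d t * C.phibar c s + if c = d ∧ s + t = -1 then 1 else 0 := by
  rw [phibar, phi, psibar0_mul_psi0]
  congr 1
  refine if_congr ?_ rfl rfl
  rw [flat_eq_flat_iff, and_assoc]
  refine and_congr_right fun _ => ?_
  have h1 := Int.mul_ediv_add_emod s C.m
  have h2 := Int.mul_ediv_add_emod (-t - 1) C.m
  constructor
  · rintro ⟨h3, h4⟩
    have h5 : s / (C.m : ℤ) = (-t - 1) / C.m := by linarith
    rw [h3, h5] at h1
    linarith
  · intro h
    obtain rfl : s = -t - 1 := by linarith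
    exact ⟨rfl, by ring⟩

lemma phi_smul_vac (c : Fin C.n) {t : ℤ} (ht : 0 ≤ t) : C.phi c t • C.vac = 0 := by
  refine C.psi0_smul_vac _ ?_
  have : (-t - 1) / (C.m : ℤ) < 0 := Int.ediv_neg_of_neg_of_pos (by omega) C.m_pos
  linarith

lemma phibar_smul_vac (c : Fin C.n) {t : ℤ} (ht : 0 ≤ t) : C.phibar c t • C.vac = 0 :=
  C.psibar0_smul_vac _ (Int.ediv_nonneg ht C.m_pos.le)

/-- The creation operator attached to a variable of the polynomial model. -/
def creation (v : Var C.n) : C.W :=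
  bif v.1 then C.phibar v.2.1 (-((v.2.2 : ℤ) + 1)) else C.phi v.2.1 (-((v.2.2 : ℤ) + 1))

lemma creation_comm (v w : Var C.n) :
    C.creation v * C.creation w = C.creation w * C.creation v := by
  obtain ⟨_ | _, c, t⟩ := v <;> obtain ⟨_ | _, d, u⟩ := w <;> simp only [creation, cond]
  · exact C.phi_comm _ _ _ _
  · rw [phibar_mul_phi, if_neg (by omega), add_zero]
  · rw [phibar_mul_phi, if_neg (by omega), add_zero]
  · exact C.phibar_comm _ _ _ _

open scoped IsMulCommutative in
/-- Polynomials in the creation operators. -/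
def toW : MvPolynomial (Var C.n) ℂ →ₐ[ℂ] C.W :=
  haveI : IsMulCommutative (Algebra.adjoin ℂ (Set.range C.creation)) :=
    Algebra.isMulCommutative_adjoin ℂ (by
      rintro _ ⟨v, rfl⟩ _ ⟨w, rfl⟩
      exact C.creation_comm v w)
  (Algebra.adjoin ℂ (Set.range C.creation)).val.comp
    (aeval (R := ℂ) (S₁ := Algebra.adjoin ℂ (Set.range C.creation))
      fun v => ⟨C.creation v, Algebra.subset_adjoin ⟨v, rfl⟩⟩)

lemma toW_X (v : Var C.n) : C.toW (X v) = C.creation v := by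
  simp [toW]

lemma phibar_mul_toW (c : Fin C.n) (s : ℕ) (f : MvPolynomial (Var C.n) ℂ) :
    C.phibar c s * C.toW f = C.toW f * C.phibar c s + C.toW (pderiv (false, c, s) f) := by
  induction f using MvPolynomial.induction_on with
  | C a =>
    rw [pderiv_C, map_zero, add_zero, ← algebraMap_eq, AlgHom.commutes]
    exact (Algebra.commutes a _).symm
  | add f g hf hg =>
    rw [map_add, map_add, map_add, mul_add, add_mul, hf, hg]
    abel
  | mul_X f v hf =>
    have hv : C.phibar c s * C.creation v
        = C.creation v * C.phibar c s + C.toW (pderiv (false, c, s) (X v)) := by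
      rw [pderiv_X, Pi.single_apply]
      obtain ⟨_ | _, d, u⟩ := v <;> simp only [creation, cond]
      · rw [phibar_mul_phi]
        congr 1
        by_cases h : c = d ∧ s = u
        · obtain ⟨rfl, rfl⟩ := h
          simp
        · rw [if_neg (fun h' => h ⟨h'.1, by omega⟩), if_neg, map_zero]
          simp only [Prod.mk.injEq, true_and]
          exact fun h' => h ⟨h'.1.symm, h'.2.symm⟩
      · rw [phibar_comm]
        simp
    rw [map_mul, toW_X, ← mul_assoc, hf, add_mul, mul_assoc, hv, mul_add, pderiv_mul, map_add,
      map_mul, map_mul, toW_X, ← mul_assoc]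
    abel

lemma phi_mul_toW (c : Fin C.n) (t : ℕ) (f : MvPolynomial (Var C.n) ℂ) :
    C.phi c t * C.toW f = C.toW f * C.phi c t - C.toW (pderiv (true, c, t) f) := by
  induction f using MvPolynomial.induction_on with
  | C a =>
    rw [pderiv_C, map_zero, sub_zero, ← algebraMap_eq, AlgHom.commutes]
    exact (Algebra.commutes a _).symm
  | add f g hf hg =>
    rw [map_add, map_add, map_add, mul_add, add_mul, hf, hg]
    abel
  | mul_X f v hf =>
    have hv : C.phi c t * C.creation v
        = C.creation v * C.phi c t - C.toW (pderiv (true, c, t) (X v)) := by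
      rw [pderiv_X, Pi.single_apply]
      obtain ⟨_ | _, d, u⟩ := v <;> simp only [creation, cond]
      · rw [phi_comm]
        simp
      · rw [phibar_mul_phi, eq_sub_iff_add_eq]
        congr 1
        by_cases h : d = c ∧ u = t
        · obtain ⟨rfl, rfl⟩ := h
          simp
        · rw [if_neg (show ¬((true, d, u) : Var C.n) = (true, c, t) by
              simpa only [Prod.mk.injEq, true_and] using h),
            if_neg (fun h' => h ⟨h'.1, by omega⟩), map_zero]
    rw [map_mul, toW_X, ← mul_assoc, hf, sub_mul, mul_assoc, hv, mul_sub, pderiv_mul, map_add,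
      map_mul, map_mul, toW_X, ← mul_assoc]
    abel

/-- The polynomial model of the Fock module: `f ↦ f |0⟩`. -/
def toF : MvPolynomial (Var C.n) ℂ →ₗ[ℂ] C.F :=
  ((LinearMap.toSpanSingleton C.W C.F C.vac).restrictScalars ℂ).comp C.toW.toLinearMap

lemma toF_apply (f : MvPolynomial (Var C.n) ℂ) : C.toF f = C.toW f • C.vac := rfl

lemma creation_smul_toF (v : Var C.n) (f : MvPolynomial (Var C.n) ℂ) :
    C.creation v • C.toF f = C.toF (X v * f) := by
  rw [toF_apply, toF_apply, map_mul, toW_X, mul_smul]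

lemma phi_smul_toF_of_neg (c : Fin C.n) {t : ℤ} (ht : t < 0) (f : MvPolynomial (Var C.n) ℂ) :
    C.phi c t • C.toF f = C.toF (X (false, c, (-t - 1).toNat) * f) := by
  rw [← creation_smul_toF, creation, cond]
  congr 2
  simp only
  omega

lemma phibar_smul_toF_of_neg (c : Fin C.n) {t : ℤ} (ht : t < 0)
    (f : MvPolynomial (Var C.n) ℂ) :
    C.phibar c t • C.toF f = C.toF (X (true, c, (-t - 1).toNat) * f) := by
  rw [← creation_smul_toF, creation, cond]
  congr 2
  simp only
  omega

lemma phi_smul_toF_of_nonneg (c : Fin C.n) {t : ℤ} (ht : 0 ≤ t) (f : MvPolynomial (Var C.n) ℂ) :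
    C.phi c t • C.toF f = -C.toF (pderiv (true, c, t.toNat) f) := by
  lift t to ℕ using ht
  rw [toF_apply, ← mul_smul, phi_mul_toW, sub_smul, mul_smul, phi_smul_vac _ _ (by omega),
    smul_zero, zero_sub, toF_apply]
  rfl

lemma phibar_smul_toF_of_nonneg (c : Fin C.n) {t : ℤ} (ht : 0 ≤ t)
    (f : MvPolynomial (Var C.n) ℂ) :
    C.phibar c t • C.toF f = C.toF (pderiv (false, c, t.toNat) f) := by
  lift t to ℕ using ht
  rw [toF_apply, ← mul_smul, phibar_mul_toW, add_smul, mul_smul, phibar_smul_vac _ _ (by omega),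
    smul_zero, zero_add, toF_apply]
  rfl

lemma ncdet_eq_toW {l : ℕ} (M : Fin l → Fin l → C.W)
    (P : Matrix (Fin l) (Fin l) (MvPolynomial (Var C.n) ℂ)) (h : ∀ i j, M i j = C.toW (P i j)) :
    C.ncdet M = C.toW P.det := by
  rw [Matrix.det_apply, map_sum, ncdet]
  refine Finset.sum_congr rfl fun σ _ => ?_
  rw [Units.smul_def, map_zsmul, Fin.prod_univ_def, map_list_prod, List.map_map]
  congr 3
  exact funext fun t => h _ _

lemma Adet_eq {l : ℕ} (hl : l ≤ C.n) : C.Adet l = C.toW (varDet false (rowsUp C.hn) l) := by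
  refine C.ncdet_eq_toW _ _ fun i j => ?_
  have h : ((rowsUp C.hn i : Fin C.n) : ℕ) = i := Nat.mod_eq_of_lt (by omega)
  rw [Matrix.of_apply, toW_X, creation, cond, ← PhiW_eq, h]

lemma Abar_eq {l : ℕ} (hl : 1 ≤ l) :
    C.Abar l = C.toW (varDet true (rowsDown C.hn) (C.n - l + 1)) := by
  refine C.ncdet_eq_toW _ _ fun i j => ?_
  have h : ((rowsDown C.hn i : Fin C.n) : ℕ) = C.n - 1 - i := rfl
  have := C.hn
  rw [Matrix.of_apply, toW_X, creation, cond, ← PhibarW_eq, h]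
  congr 1
  omega

lemma pderiv_comm {σ : Type*} (i j : σ) (f : MvPolynomial σ ℂ) :
    pderiv i (pderiv j f) = pderiv j (pderiv i f) := by
  classical
  have h : ⁅pderiv (R := ℂ) i, pderiv (R := ℂ) j⁆ = 0 := by
    refine derivation_ext fun k => ?_
    rw [Derivation.commutator_apply, pderiv_X, pderiv_X, Pi.single_apply, Pi.single_apply]
    split_ifs <;> simp
  have h' := congrArg (fun D => D f) h
  rw [Derivation.commutator_apply] at h'
  exact sub_eq_zero.1 h'

/-- The operator on polynomials corresponding to `phi`. -/
def opPhi (c : Fin C.n) (t : ℤ) : Module.End ℂ (MvPolynomial (Var C.n) ℂ) :=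
  if t < 0 then LinearMap.mulLeft ℂ (X (false, c, (-t - 1).toNat))
  else -(pderiv (true, c, t.toNat)).toLinearMap

/-- The operator on polynomials corresponding to `phibar`. -/
def opPhibar (c : Fin C.n) (t : ℤ) : Module.End ℂ (MvPolynomial (Var C.n) ℂ) :=
  if t < 0 then LinearMap.mulLeft ℂ (X (true, c, (-t - 1).toNat))
  else (pderiv (false, c, t.toNat)).toLinearMap

lemma opPhi_comm (c d : Fin C.n) (t u : ℤ) :
    C.opPhi c t * C.opPhi d u = C.opPhi d u * C.opPhi c t := by
  refine LinearMap.ext fun f => ?_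
  simp only [opPhi, Module.End.mul_apply]
  split_ifs
  · simp [mul_left_comm]
  · simp [pderiv_X]
  · simp [pderiv_X]
  · simp [pderiv_comm (true, c, t.toNat)]

lemma opPhibar_comm (c d : Fin C.n) (t u : ℤ) :
    C.opPhibar c t * C.opPhibar d u = C.opPhibar d u * C.opPhibar c t := by
  refine LinearMap.ext fun f => ?_
  simp only [opPhibar, Module.End.mul_apply]
  split_ifs
  · simp [mul_left_comm]
  · simp [pderiv_X]
  · simp [pderiv_X]
  · simp [pderiv_comm (false, c, t.toNat)]

lemma opPhibar_mul_opPhi (c d : Fin C.n) (s t : ℤ) :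
    C.opPhibar c s * C.opPhi d t
      = C.opPhi d t * C.opPhibar c s + if c = d ∧ s + t = -1 then 1 else 0 := by
  refine LinearMap.ext fun f => ?_
  by_cases hs : s < 0 <;> by_cases ht : t < 0
  · rw [if_neg (by omega)]
    simp [opPhi, opPhibar, hs, ht, mul_left_comm]
  · by_cases h : c = d ∧ s + t = -1
    · have h2 : (-s - 1).toNat = t.toNat := by omega
      simp [opPhi, opPhibar, hs, ht, h.1, h.2, h2, pderiv_X]
    · have h2 : pderiv ((true, d, t.toNat) : Var C.n)
          (X (true, c, (-s - 1).toNat) : MvPolynomial (Var C.n) ℂ) = 0 :=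
        pderiv_X_of_ne fun h' => h ⟨congrArg (fun v => v.2.1) h',
          by have := congrArg (fun v => v.2.2) h'; simp only at this; omega⟩
      rw [if_neg h]
      simp only [opPhi, opPhibar, hs, ht, if_true, if_false, Module.End.mul_apply,
        LinearMap.add_apply, LinearMap.neg_apply, LinearMap.mulLeft_apply, Derivation.coeFn_coe,
        pderiv_mul, h2]
      simp
  · by_cases h : c = d ∧ s + t = -1
    · have h2 : (-t - 1).toNat = s.toNat := by omega
      simp [opPhi, opPhibar, hs, ht, h.1, h.2, h2, pderiv_X,
        add_comm]
    · have h2 : pderiv ((false, c, s.toNat) : Var C.n)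
          (X (false, d, (-t - 1).toNat) : MvPolynomial (Var C.n) ℂ) = 0 :=
        pderiv_X_of_ne fun h' => h ⟨(congrArg (fun v => v.2.1) h').symm,
          by have := congrArg (fun v => v.2.2) h'; simp only at this; omega⟩
      rw [if_neg h]
      simp only [opPhi, opPhibar, hs, ht, if_true, if_false, Module.End.mul_apply,
        LinearMap.add_apply, LinearMap.mulLeft_apply, Derivation.coeFn_coe,
        pderiv_mul, h2]
      simp
  · rw [if_neg (by omega)]
    simp [opPhi, opPhibar, hs, ht, pderiv_comm (false, c, s.toNat)]

/-- The superscript (starting at `0`) of a flat index. -/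
def block (i : Fin C.NN) : Fin C.n := ⟨i / C.m, Nat.div_lt_of_lt_mul i.2⟩

/-- The action of the generators on polynomials. -/
def opGen (g : C.Gen) : Module.End ℂ (MvPolynomial (Var C.n) ℂ) :=
  match g with
  | (Sum.inl i, k) => C.opPhi (C.block i) ((k + C.sig) * C.m - ((i % C.m : ℕ) : ℤ) - 1)
  | (Sum.inr i, k) => C.opPhibar (C.block i) (k * C.m + ((i % C.m : ℕ) : ℤ))

lemma index_eq_iff (i j : Fin C.NN) (k l : ℤ) :
    (C.block i = C.block j ∧
      k * C.m + ((i % C.m : ℕ) : ℤ) + ((l + C.sig) * C.m - ((j % C.m : ℕ) : ℤ) - 1) = -1)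
      ↔ i = j ∧ k + l + C.sig = 0 := by
  have hm := C.m_pos
  have h1 : ((i % C.m : ℕ) : ℤ) < C.m := by exact_mod_cast Nat.mod_lt _ C.hm
  have h2 : ((j % C.m : ℕ) : ℤ) < C.m := by exact_mod_cast Nat.mod_lt _ C.hm
  have h1' : (0 : ℤ) ≤ ((i % C.m : ℕ) : ℤ) := Int.natCast_nonneg _
  have h2' : (0 : ℤ) ≤ ((j % C.m : ℕ) : ℤ) := Int.natCast_nonneg _
  constructor
  · rintro ⟨hb, h⟩
    have h3 : (k + l + C.sig) * C.m = ((j % C.m : ℕ) : ℤ) - ((i % C.m : ℕ) : ℤ) := by linarith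
    have h4 : k + l + C.sig = 0 := by
      by_contra hne
      rcases lt_or_gt_of_ne hne with h5 | h5 <;> nlinarith
    rw [h4, zero_mul] at h3
    have h6 : (i : ℕ) % C.m = j % C.m := by omega
    have h7 : (i : ℕ) / C.m = j / C.m := congrArg Fin.val hb
    refine ⟨Fin.ext ?_, h4⟩
    rw [← Nat.div_add_mod i C.m, ← Nat.div_add_mod j C.m, h6, h7]
  · rintro ⟨rfl, h⟩
    refine ⟨rfl, ?_⟩
    have : (k + l + C.sig) * C.m = 0 := by rw [h, zero_mul]
    linarith

/-- The action of `W_N(S)` on polynomials. -/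
def polyRep : C.W →ₐ[ℂ] Module.End ℂ (MvPolynomial (Var C.n) ℂ) :=
  RingQuot.liftAlgHom ℂ ⟨FreeAlgebra.lift ℂ C.opGen, by
    rintro _ _ (⟨i, j, k, l⟩ | ⟨i, j, k, l⟩ | ⟨i, j, k, l⟩)
    · simpa [opGen] using C.opPhi_comm _ _ _ _
    · simpa [opGen] using C.opPhibar_comm _ _ _ _
    · simp only [map_mul, map_add, FreeAlgebra.lift_ι_apply, opGen, opPhibar_mul_opPhi,
        index_eq_iff]
      split_ifs <;> simp⟩

lemma polyRep_psi0 (i : Fin C.NN) (k : ℤ) : C.polyRep (C.psi0 i k)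
    = C.opPhi (C.block i) ((k + C.sig) * C.m - ((i % C.m : ℕ) : ℤ) - 1) :=
  (RingQuot.liftAlgHom_mkAlgHom_apply ℂ _ _ _).trans (FreeAlgebra.lift_ι_apply _ _)

lemma polyRep_psibar0 (i : Fin C.NN) (k : ℤ) : C.polyRep (C.psibar0 i k)
    = C.opPhibar (C.block i) (k * C.m + ((i % C.m : ℕ) : ℤ)) :=
  (RingQuot.liftAlgHom_mkAlgHom_apply ℂ _ _ _).trans (FreeAlgebra.lift_ι_apply _ _)

lemma block_flat (c : Fin C.n) (t : ℤ) : C.block (C.flat c t) = c := by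
  have h1 := Int.emod_lt_of_pos t C.m_pos
  have h2 := Int.emod_nonneg t C.m_pos.ne'
  refine Fin.ext ?_
  change ((t % C.m).toNat + c * C.m) / C.m = c
  rw [Nat.add_mul_div_right _ _ C.hm, Nat.div_eq_of_lt (by omega), zero_add]

lemma flat_mod (c : Fin C.n) (t : ℤ) : ((C.flat c t % C.m : ℕ) : ℤ) = t % C.m := by
  have h1 := Int.emod_lt_of_pos t C.m_pos
  have h2 := Int.emod_nonneg t C.m_pos.ne'
  change ((((t % C.m).toNat + c * C.m) % C.m : ℕ) : ℤ) = _
  rw [Nat.add_mul_mod_self_right, Nat.mod_eq_of_lt (by omega)]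
  omega

lemma polyRep_phi (c : Fin C.n) (t : ℤ) : C.polyRep (C.phi c t) = C.opPhi c t := by
  rw [phi, polyRep_psi0, block_flat, flat_mod]
  congr 1
  linarith [Int.mul_ediv_add_emod (-t - 1) C.m]

lemma polyRep_phibar (c : Fin C.n) (t : ℤ) : C.polyRep (C.phibar c t) = C.opPhibar c t := by
  rw [phibar, polyRep_psibar0, block_flat, flat_mod]
  congr 1
  linarith [Int.mul_ediv_add_emod t C.m]

lemma polyRep_toW (f : MvPolynomial (Var C.n) ℂ) : C.polyRep (C.toW f) = LinearMap.mulLeft ℂ f := by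
  have h : C.polyRep.comp C.toW = Algebra.lmul ℂ (MvPolynomial (Var C.n) ℂ) := by
    refine MvPolynomial.algHom_ext fun v => LinearMap.ext fun f => ?_
    rw [AlgHom.comp_apply, toW_X]
    obtain ⟨_ | _, c, t⟩ := v
    · rw [creation, cond, polyRep_phi, opPhi, if_pos (by simp only; omega)]
      simp
    · rw [creation, cond, polyRep_phibar, opPhibar, if_pos (by simp only; omega)]
      simp
  exact DFunLike.congr_fun h f

lemma polyRep_one_of_mem {w : C.W} (hw : w ∈ C.vacIdeal) : C.polyRep w 1 = 0 := by
  induction hw using Submodule.span_induction with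
  | zero => simp
  | add x y _ _ hx hy => rw [map_add, LinearMap.add_apply, hx, hy, add_zero]
  | smul a x _ hx => rw [smul_eq_mul, map_mul, Module.End.mul_apply, hx, map_zero]
  | mem x hx =>
    have hpsi : ∀ (i : Fin C.NN) (k : ℤ), 0 < k + C.sig → C.polyRep (C.psi0 i k) 1 = 0 := by
      intro i k hk
      have h1 : ((i % C.m : ℕ) : ℤ) < C.m := by exact_mod_cast Nat.mod_lt _ C.hm
      rw [polyRep_psi0, opPhi, if_neg (by nlinarith [C.m_pos])]
      simp
    have hpsibar : ∀ (i : Fin C.NN) (k : ℤ), 0 ≤ k → C.polyRep (C.psibar0 i k) 1 = 0 := by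
      intro i k hk
      rw [polyRep_psibar0, opPhibar, if_neg (by nlinarith [C.m_pos, Int.natCast_nonneg (i % C.m : ℕ)])]
      simp
    have hsig := C.hsig
    rcases hx with ⟨i, k, hk, rfl | rfl⟩ | ⟨_, i, rfl⟩
    · exact hpsi i k (by omega)
    · exact hpsibar i k (by omega)
    · exact hpsibar i 0 le_rfl

lemma toF_ne_zero {f : MvPolynomial (Var C.n) ℂ} (hf : f ≠ 0) : C.toF f ≠ 0 := by
  intro h
  have h1 : C.toW f * 1 ∈ C.vacIdeal := (Submodule.Quotient.mk_eq_zero _).1 h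
  have h2 := C.polyRep_one_of_mem h1
  rw [mul_one, polyRep_toW, LinearMap.mulLeft_apply, mul_one] at h2
  exact hf h2

lemma nord_phi_phibar_of_comm (c d : Fin C.n) {s t : ℤ} (k : ℤ) (h : s + t ≠ -1) :
    C.nord (C.phi c t) k (C.phibar d s) = C.phi c t * C.phibar d s := by
  have h' : C.phibar d s * C.phi c t = C.phi c t * C.phibar d s := by
    rw [phibar_mul_phi, if_neg (fun h' => h h'.2), add_zero]
  rw [nord, h', ← two_smul ℂ, smul_smul, inv_mul_cancel₀ two_ne_zero, one_smul]
  split_ifs <;> rfl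

/-- The polynomial form of the mode `:φ^c_{-s-1} φ̄^d_s:`, up to a scalar. -/
def modeOp (c d : Fin C.n) (s : ℤ) :
    Derivation ℂ (MvPolynomial (Var C.n) ℂ) (MvPolynomial (Var C.n) ℂ) :=
  if 0 ≤ s then (X (false, c, s.toNat) : MvPolynomial (Var C.n) ℂ) • pderiv (false, d, s.toNat)
  else -((X (true, d, (-s - 1).toNat) : MvPolynomial (Var C.n) ℂ) •
    pderiv (true, c, (-s - 1).toNat))

lemma modeOp_of_nonneg (c d : Fin C.n) {s : ℤ} (hs : 0 ≤ s) (f : MvPolynomial (Var C.n) ℂ) :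
    C.modeOp c d s f = X (false, c, s.toNat) * pderiv (false, d, s.toNat) f := by
  rw [modeOp, if_pos hs]
  rfl

lemma modeOp_of_neg (c d : Fin C.n) {s : ℤ} (hs : s < 0) (f : MvPolynomial (Var C.n) ℂ) :
    C.modeOp c d s f = -(X (true, d, (-s - 1).toNat) * pderiv (true, c, (-s - 1).toNat) f) := by
  rw [modeOp, if_neg hs.not_ge]
  rfl

lemma phi_mul_phibar_smul_toF (c d : Fin C.n) {s : ℤ} (hs : 0 ≤ s)
    (f : MvPolynomial (Var C.n) ℂ) :
    (C.phi c (-s - 1) * C.phibar d s) • C.toF f = C.toF (C.modeOp c d s f) := by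
  rw [mul_smul, phibar_smul_toF_of_nonneg _ _ hs, phi_smul_toF_of_neg _ _ (by omega),
    modeOp_of_nonneg _ _ _ hs, show -(-s - 1) - 1 = s by ring]

lemma phibar_mul_phi_smul_toF (c d : Fin C.n) {s : ℤ} (hs : s < 0)
    (f : MvPolynomial (Var C.n) ℂ) :
    (C.phibar d s * C.phi c (-s - 1)) • C.toF f = C.toF (C.modeOp c d s f) := by
  rw [mul_smul, phi_smul_toF_of_nonneg _ _ (by omega), smul_neg, phibar_smul_toF_of_neg _ _ hs,
    modeOp_of_neg _ _ _ hs, map_neg]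

lemma nord_smul_toF (c d : Fin C.n) {s k : ℤ} (hk : 0 ≤ k ↔ 0 ≤ s)
    (f : MvPolynomial (Var C.n) ℂ) :
    C.nord (C.phi c (-s - 1)) k (C.phibar d s) • C.toF f
      = C.toF (C.modeOp c d s f) + (if c = d ∧ k = 0 then C.eps else 0) • C.toF f := by
  have hsig := C.hsig
  rcases lt_trichotomy k 0 with h | rfl | h
  · rw [nord, if_neg (by omega), if_neg (by omega), phibar_mul_phi_smul_toF _ _ _ (by omega),
      if_neg (by omega), zero_smul, add_zero]
  · rcases hsig with h0 | h1
    · rw [nord, if_neg (by omega), if_pos (by omega), phibar_mul_phi, ← add_assoc,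
        ← two_smul ℂ (_ * _), smul_add, smul_smul, inv_mul_cancel₀ two_ne_zero, one_smul,
        add_smul, phi_mul_phibar_smul_toF _ _ _ (by omega)]
      congr 1
      by_cases hcd : c = d
      · rw [if_pos ⟨hcd.symm, by ring⟩, if_pos ⟨hcd, rfl⟩, smul_assoc, one_smul, eps, h0]
        norm_num
      · rw [if_neg (fun h => hcd h.1.symm), if_neg (fun h => hcd h.1), smul_zero, zero_smul,
          zero_smul]
    · rw [nord, if_pos (by omega), phi_mul_phibar_smul_toF _ _ _ (by omega), eps, h1]
      simp
  · rw [nord, if_pos (by omega), phi_mul_phibar_smul_toF _ _ _ (by omega),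
      if_neg (by omega), zero_smul, add_zero]

section DetVec

variable {p s : ℕ} (eA eB : ℕ → ℕ)

lemma sum_phi_mul_phibar_smul_toF (hp : p < s) (hs : s ≤ C.n + 1) {u t : ℤ} (h : 0 ≤ u + t) :
    ∑ c : Fin C.n, (C.phi c t * C.phibar c u) • C.toF (detVec C.hn p s eA eB) = 0 := by
  have hcomm : ∀ c, C.phi c t * C.phibar c u = C.phibar c u * C.phi c t := fun c => by
    rw [phibar_mul_phi, if_neg (by omega), add_zero]
  rcases lt_or_ge u 0 with hu | hu
  · have h1 := colOp_detVec_of_lt (p := p) (s := s) C.hn eA eB true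
      (show (-u - 1).toNat < t.toNat by omega)
    rw [colOp_apply] at h1
    rw [← neg_zero, ← map_zero C.toF, ← h1, map_sum, ← Finset.sum_neg_distrib]
    refine Finset.sum_congr rfl fun c _ => ?_
    rw [hcomm, mul_smul, phi_smul_toF_of_nonneg _ _ (by omega), smul_neg,
      phibar_smul_toF_of_neg _ _ hu]
  · rcases lt_or_ge t 0 with ht | ht
    · have h1 := colOp_detVec_of_lt (p := p) (s := s) C.hn eA eB false
        (show (-t - 1).toNat < u.toNat by omega)
      rw [colOp_apply] at h1
      rw [← map_zero C.toF, ← h1, map_sum]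
      refine Finset.sum_congr rfl fun c _ => ?_
      rw [mul_smul, phibar_smul_toF_of_nonneg _ _ hu, phi_smul_toF_of_neg _ _ ht]
    · refine Finset.sum_eq_zero fun c _ => ?_
      rcases lt_or_ge (c : ℕ) p with hc | hc
      · rw [hcomm, mul_smul, phi_smul_toF_of_nonneg _ _ ht, pderiv_true_detVec _ _ _ hs _ _ (by omega),
          map_zero, neg_zero, smul_zero]
      · rw [mul_smul, phibar_smul_toF_of_nonneg _ _ hu, pderiv_false_detVec _ _ _ _ _ hc,
          map_zero, smul_zero]

end DetVec

lemma finsum_int_eq_sum_range {M : Type*} [AddCommMonoid M] (n : ℕ) (f : ℤ → M)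
    (h1 : ∀ k : ℕ, n ≤ k → f k = 0) (h2 : ∀ k : ℕ, n ≤ k → f (-k - 1) = 0) :
    ∑ᶠ k, f k = ∑ k ∈ Finset.range n, f k + ∑ k ∈ Finset.range n, f (-k - 1) := by
  rw [finsum_eq_sum_of_support_subset (s := Finset.Ico (-n : ℤ) n)]
  · rw [add_comm, ← Finset.Ico_union_Ico_eq_Ico (show -(n : ℤ) ≤ 0 by omega)
      (show (0 : ℤ) ≤ n by omega), Finset.sum_union (Finset.Ico_disjoint_Ico_consecutive _ _ _)]
    congr 1
    · symm
      refine Finset.sum_bij (fun k _ => -(k : ℤ) - 1) ?_ ?_ ?_ fun _ _ => rfl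
      · simp only [Finset.mem_range, Finset.mem_Ico]; omega
      · omega
      · simp only [Finset.mem_range, Finset.mem_Ico]
        exact fun b hb => ⟨(-b - 1).toNat, by omega, by omega⟩
    · symm
      refine Finset.sum_bij (fun k _ => (k : ℤ)) ?_ ?_ ?_ fun _ _ => rfl
      · simp only [Finset.mem_range, Finset.mem_Ico]; omega
      · omega
      · simp only [Finset.mem_range, Finset.mem_Ico]
        exact fun b hb => ⟨b.toNat, by omega, by omega⟩
  · intro k hk
    simp only [Finset.coe_Ico, Set.mem_Ico]
    by_contra hne
    rcases lt_or_ge k 0 with h0 | h0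
    · have := h2 (-k - 1).toNat (by omega)
      rw [show -((-k - 1).toNat : ℤ) - 1 = k by omega] at this
      exact hk this
    · have := h1 k.toNat (by omega)
      rw [show (k.toNat : ℤ) = k by omega] at this
      exact hk this

lemma sum_range_sum_range_mul_add {M : Type*} [AddCommMonoid M] (n m : ℕ) (g : ℕ → M) :
    ∑ k ∈ Finset.range n, ∑ c ∈ Finset.range m, g (k * m + c) = ∑ t ∈ Finset.range (n * m), g t := by
  induction n with
  | zero => simp
  | succ n ih => rw [Finset.sum_range_succ, ih, Nat.succ_mul, Finset.sum_range_add]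

lemma nord_psiS_psibarS_smul_toF (c d : Fin C.n) {i : ℕ} (hi : 1 ≤ i) (him : i ≤ C.m) (k : ℤ)
    (f : MvPolynomial (Var C.n) ℂ) :
    C.nord (C.psiS i (c + 1) (-k - C.sig)) k (C.psibarS i (d + 1) k) • C.toF f
      = C.toF (C.modeOp c d (k * C.m + (i - 1)) f)
        + (if c = d ∧ k = 0 then C.eps else 0) • C.toF f := by
  have hm := C.m_pos
  rw [psiS_eq _ _ hi him, psibarS_eq _ _ hi him, ← nord_smul_toF]
  · congr 3
    ring
  · constructor
    · intro h
      nlinarith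
    · intro h
      by_contra hk
      nlinarith

lemma finsum_nord_psiS_psibarS_smul_toF (r r' : Fin C.n) (f : MvPolynomial (Var C.n) ℂ)
    (hf : ∀ b c t, C.n ≤ t → pderiv (b, c, t) f = 0) :
    ∑ᶠ k : ℤ, (∑ c : Fin C.m, C.nord (C.psiS ((c : ℕ) + 1) (r + 1) (-k - C.sig)) k
        (C.psibarS ((c : ℕ) + 1) (r' + 1) k)) • C.toF f
      = C.toF (rowOp false r r' (C.n * C.m) f - rowOp true r' r (C.n * C.m) f)
        + (if r = r' then C.eps * C.m else 0) • C.toF f := by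
  have hm := C.hm
  have hn := C.hn
  have hterm : ∀ k : ℤ, (∑ c : Fin C.m, C.nord (C.psiS ((c : ℕ) + 1) (r + 1) (-k - C.sig)) k
        (C.psibarS ((c : ℕ) + 1) (r' + 1) k)) • C.toF f
      = C.toF (∑ c ∈ Finset.range C.m, C.modeOp r r' (k * C.m + c) f)
        + (if k = 0 then (if r = r' then C.eps * C.m else 0) else 0) • C.toF f := by
    intro k
    rw [Finset.sum_smul, Finset.sum_range, map_sum]
    have : ∀ c : Fin C.m, C.nord (C.psiS ((c : ℕ) + 1) (r + 1) (-k - C.sig)) k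
        (C.psibarS ((c : ℕ) + 1) (r' + 1) k) • C.toF f
        = C.toF (C.modeOp r r' (k * C.m + (c : ℕ)) f)
          + (if r = r' ∧ k = 0 then C.eps else 0) • C.toF f := fun c => by
      rw [nord_psiS_psibarS_smul_toF _ _ _ (by omega) (by omega)]
      congr 4
      push_cast
      ring
    rw [Finset.sum_congr rfl fun c _ => this c, Finset.sum_add_distrib, Finset.sum_const,
      Finset.card_univ, Fintype.card_fin, ← Nat.cast_smul_eq_nsmul ℂ, smul_smul]
    congr 2
    by_cases h1 : r = r' <;> by_cases h2 : k = 0 <;> simp [h1, h2, mul_comm]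
  have hpos : ∀ k c : ℕ, C.modeOp r r' ((k : ℤ) * C.m + c) f
      = X (false, r, k * C.m + c) * pderiv (false, r', k * C.m + c) f := fun k c => by
    rw [modeOp_of_nonneg _ _ _ (by positivity)]
    congr
  have hneg : ∀ k c : ℕ, c < C.m → C.modeOp r r' ((-(k : ℤ) - 1) * C.m + c) f
      = -(X (true, r', k * C.m + (C.m - 1 - c)) * pderiv (true, r, k * C.m + (C.m - 1 - c)) f) :=
    fun k c hc => by
      have h : -((-(k : ℤ) - 1) * C.m + c) - 1 = ((k * C.m + (C.m - 1 - c) : ℕ) : ℤ) := by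
        push_cast [Nat.sub_sub, Nat.cast_sub (show 1 + c ≤ C.m by omega)]
        ring
      rw [modeOp_of_neg _ _ _ (by omega), h, Int.toNat_natCast]
  rw [finsum_int_eq_sum_range C.n]
  · simp only [hterm]
    rw [Finset.sum_add_distrib, ← Finset.sum_smul, Finset.sum_add_distrib, ← Finset.sum_smul,
      ← map_sum, ← map_sum, Finset.sum_eq_single 0
        (f := fun k : ℕ => if (k : ℤ) = 0 then (if r = r' then C.eps * C.m else 0) else 0),
      Finset.sum_eq_zero
        (f := fun k : ℕ => if -(k : ℤ) - 1 = 0 then (if r = r' then C.eps * C.m else 0) else 0),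
      zero_smul, add_zero, add_right_comm, ← map_add]
    · congr 2
      rw [rowOp_apply, rowOp_apply, sub_eq_add_neg, ← sum_range_sum_range_mul_add,
        ← sum_range_sum_range_mul_add, ← Finset.sum_neg_distrib]
      refine congrArg₂ _
        (Finset.sum_congr rfl fun k _ => Finset.sum_congr rfl fun c _ => hpos k c) ?_
      refine Finset.sum_congr rfl fun k _ => ?_
      rw [← Finset.sum_neg_distrib, ← Finset.sum_range_reflect]
      refine Finset.sum_congr rfl fun c hc => ?_
      rw [Finset.mem_range] at hc
      rw [hneg k _ (by omega), Nat.sub_sub_self (by omega)]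
    · exact fun k _ => if_neg (by omega)
    · exact fun k _ hk => if_neg (by omega)
    · exact fun h => absurd (Finset.mem_range.2 hn) h
  · intro k hk
    rw [hterm, if_neg (by omega), zero_smul, add_zero, Finset.sum_eq_zero, map_zero]
    intro c _
    rw [hpos, hf _ _ _ (by nlinarith), mul_zero]
  · intro k hk
    rw [hterm, if_neg (by omega), zero_smul, add_zero, Finset.sum_eq_zero, map_zero]
    intro c hc
    rw [hneg _ _ (Finset.mem_range.1 hc), hf _ _ _ (by nlinarith [Nat.zero_le (C.m - 1 - c)]), mul_zero, neg_zero]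

/-- The exponent of `A_{i+1}` in the highest weight vector. -/
def expA (μ : ℕ → ℤ) (p i : ℕ) : ℕ :=
  if i + 1 < p then (μ (i + 1) - μ (i + 2)).toNat else (μ p).toNat

/-- The exponent of `Ā_{s+i}` in the highest weight vector. -/
def expB (μ : ℕ → ℤ) (s i : ℕ) : ℕ :=
  if i = 0 then (-(μ s)).toNat else (μ (s + i - 1) - μ (s + i)).toNat

/-- The highest weight vector in the polynomial model. -/
def hwPoly (μ : ℕ → ℤ) (p s : ℕ) : MvPolynomial (Var C.n) ℂ :=
  detVec C.hn p s (expA μ p) (expB μ s)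

lemma list_prod_map_range {M : Type*} [CommMonoid M] (f : ℕ → M) (k : ℕ) :
    ((List.range k).map f).prod = ∏ i ∈ Finset.range k, f i := by
  rw [← List.prod_toFinset f List.nodup_range, List.toFinset_range]

lemma vGL_eq (μ : ℕ → ℤ) {p s : ℕ} (hp : p < s) (hs : s ≤ C.n + 1) :
    C.vGL μ p s = C.toF (C.hwPoly μ p s) := by
  rw [vGL, toF_apply, hwPoly, detVec, map_mul, ← list_prod_map_range, ← list_prod_map_range,
    map_list_prod, map_list_prod, List.map_map, List.map_map]
  congr 3 <;> refine List.map_congr_left fun i hi => ?_ <;>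
    rw [List.mem_range] at hi
  · rw [Function.comp_apply, map_pow, Adet_eq _ (by omega)]
    rfl
  · rw [Function.comp_apply, map_pow, Abar_eq _ (by omega)]
    rfl

/-- The eigenvalue of `∑_c :φ^c_{-u-1} φ̄^c_u:` on the highest weight vector, up to a constant. -/
def colWeight (μ : ℕ → ℤ) (p s : ℕ) (u : ℤ) : ℂ :=
  if 0 ≤ u then ∑ i ∈ Finset.range p, (expA μ p i : ℂ) * if u.toNat < i + 1 then 1 else 0
  else -∑ i ∈ Finset.range (C.n + 1 - s),
    (expB μ s i : ℂ) * if (-u - 1).toNat < C.n - (s + i) + 1 then 1 else 0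

lemma sum_modeOp_hwPoly (μ : ℕ → ℤ) (p s : ℕ) (u : ℤ) :
    ∑ c : Fin C.n, C.modeOp c c u (C.hwPoly μ p s) = C.colWeight μ p s u • C.hwPoly μ p s := by
  rw [colWeight]
  split_ifs with hu
  · rw [hwPoly, ← colOp_false_detVec, colOp_apply]
    exact Finset.sum_congr rfl fun c _ => C.modeOp_of_nonneg _ _ hu _
  · rw [hwPoly, neg_smul, ← colOp_true_detVec, colOp_apply, ← Finset.sum_neg_distrib]
    exact Finset.sum_congr rfl fun c _ => C.modeOp_of_neg _ _ (not_le.1 hu) _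

lemma pderiv_hwPoly_of_le (μ : ℕ → ℤ) {p s : ℕ} (hp : p < s) (hs : s ≤ C.n + 1) (b : Bool)
    (c : Fin C.n) (t : ℕ) (ht : C.n ≤ t) : pderiv (b, c, t) (C.hwPoly μ p s) = 0 := by
  have h : ∀ (b' : Bool) (r : ℕ → Fin C.n) (l : ℕ), l ≤ C.n →
      pderiv (b, c, t) (varDet b' r l) = 0 := fun b' r l hl =>
    derivation_det_of_forall_eq_zero _ _ fun i j => by
      rw [Matrix.of_apply, pderiv_X_of_ne]
      intro h
      have h' : (j : ℕ) = t := congrArg (fun v => v.2.2) h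
      omega
  exact derivation_detVec_eq_zero _ _ _ _ (fun i hi => h _ _ _ (by omega))
    fun i hi => h _ _ _ (by omega)

/-- `μ` is weakly decreasing on `1, …, n`, with exactly `p` positive parts and with negative parts
starting at position `s`. -/
structure Signature (n : ℕ) (μ : ℕ → ℤ) (p s : ℕ) : Prop where
  lt : p < s
  le : s ≤ n + 1
  anti : ∀ k, 1 ≤ k → k < n → μ (k + 1) ≤ μ k
  pos_iff : ∀ k, 1 ≤ k → k ≤ n → (0 < μ k ↔ k ≤ p)
  neg_iff : ∀ k, 1 ≤ k → k ≤ n → (μ k < 0 ↔ s ≤ k)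

lemma signature_of_card {n : ℕ} {μ : ℕ → ℤ} (hdec : ∀ k, 1 ≤ k → k < n → μ (k + 1) ≤ μ k) :
    Signature n μ ((Finset.Icc 1 n).filter fun k => 0 < μ k).card
      (n + 1 - ((Finset.Icc 1 n).filter fun k => μ k < 0).card) := by
  have hmono : ∀ k l, 1 ≤ k → k ≤ l → l ≤ n → μ l ≤ μ k := by
    intro k l hk hkl
    induction l, hkl using Nat.le_induction with
    | base => exact fun _ => le_rfl
    | succ l hl ih => exact fun h => (hdec l (by omega) (by omega)).trans (ih (by omega))
  set P := (Finset.Icc 1 n).filter fun k => 0 < μ k with hP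
  set Q := (Finset.Icc 1 n).filter fun k => μ k < 0 with hQ
  have hPn : P.card ≤ n := by simpa using Finset.card_filter_le (Finset.Icc 1 n) fun k => 0 < μ k
  have hQn : Q.card ≤ n := by simpa using Finset.card_filter_le (Finset.Icc 1 n) fun k => μ k < 0
  have hpos : ∀ k, 1 ≤ k → k ≤ n → (0 < μ k ↔ k ≤ P.card) := by
    intro k hk hkn
    constructor
    · intro h
      have hsub : Finset.Icc 1 k ⊆ P := fun l hl => by
        rw [Finset.mem_Icc] at hl
        rw [hP, Finset.mem_filter, Finset.mem_Icc]
        exact ⟨⟨hl.1, hl.2.trans hkn⟩, h.trans_le (hmono _ _ hl.1 hl.2 hkn)⟩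
      simpa using Finset.card_le_card hsub
    · intro h
      by_contra hneg
      have hsub : P ⊆ Finset.Icc 1 (k - 1) := fun l hl => by
        rw [hP, Finset.mem_filter, Finset.mem_Icc] at hl
        rw [Finset.mem_Icc]
        refine ⟨hl.1.1, ?_⟩
        by_contra hlk
        exact hneg (hl.2.trans_le (hmono _ _ hk (by omega) hl.1.2))
      have := Finset.card_le_card hsub
      rw [Nat.card_Icc] at this
      omega
  have hneg : ∀ k, 1 ≤ k → k ≤ n → (μ k < 0 ↔ n + 1 - Q.card ≤ k) := by
    intro k hk hkn
    constructor
    · intro h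
      have hsub : Finset.Icc k n ⊆ Q := fun l hl => by
        rw [Finset.mem_Icc] at hl
        rw [hQ, Finset.mem_filter, Finset.mem_Icc]
        exact ⟨⟨hk.trans hl.1, hl.2⟩, (hmono _ _ hk hl.1 hl.2).trans_lt h⟩
      have := Finset.card_le_card hsub
      rw [Nat.card_Icc] at this
      omega
    · intro h
      by_contra hge
      have hsub : Q ⊆ Finset.Icc (k + 1) n := fun l hl => by
        rw [hQ, Finset.mem_filter, Finset.mem_Icc] at hl
        rw [Finset.mem_Icc]
        refine ⟨?_, hl.1.2⟩
        by_contra hlk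
        exact hge ((hmono _ _ hl.1.1 (by omega) hkn).trans_lt hl.2)
      have := Finset.card_le_card hsub
      rw [Nat.card_Icc] at this
      omega
  refine ⟨?_, by omega, hdec, hpos, hneg⟩
  by_contra hle
  have h1 := (hpos P.card (by omega) hPn).2 le_rfl
  have h2 := (hneg P.card (by omega) hPn).2 (by omega)
  omega

namespace Signature

variable {n : ℕ} {μ : ℕ → ℤ} {p s : ℕ}

lemma expA_cast (h : Signature n μ p s) {i : ℕ} (hi : i < p) : (expA μ p i : ℂ)
    = (((if i + 1 ≤ p then μ (i + 1) else 0) - (if i + 2 ≤ p then μ (i + 2) else 0) : ℤ) : ℂ) := by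
  have h1 := h.lt
  have h2 := h.le
  rw [← Int.cast_natCast]
  congr 1
  rw [expA, if_pos (show i + 1 ≤ p by omega)]
  by_cases h3 : i + 1 < p
  · rw [if_pos h3, if_pos (show i + 2 ≤ p by omega), Int.toNat_of_nonneg]
    have : μ (i + 2) ≤ μ (i + 1) := h.anti (i + 1) (by omega) (by omega)
    omega
  · have := (h.pos_iff p (by omega) (by omega)).2 le_rfl
    rw [if_neg h3, if_neg (show ¬i + 2 ≤ p by omega), Int.toNat_of_nonneg this.le, sub_zero]
    congr 1
    omega

lemma expB_cast (h : Signature n μ p s) {i : ℕ} (hi : i < n + 1 - s) : (expB μ s i : ℂ)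
    = (((if s ≤ s + i - 1 then μ (s + i - 1) else 0) - (if s ≤ s + i then μ (s + i) else 0) : ℤ)
      : ℂ) := by
  have h1 := h.lt
  rw [← Int.cast_natCast]
  congr 1
  rw [expB, if_pos (show s ≤ s + i by omega)]
  split_ifs with h3
  · omega
  · have := (h.neg_iff s (by omega) (by omega)).2 le_rfl
    rw [Int.toNat_of_nonneg (by omega), h3, add_zero, zero_sub]
  · rw [Int.toNat_of_nonneg]
    have := h.anti (s + i - 1) (by omega) (by omega)
    rw [show s + i - 1 + 1 = s + i by omega] at this
    omega
  · omega

end Signature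

lemma sum_range_sub_mul_ite_lt (u : ℕ → ℤ) (c P : ℕ) :
    ∑ i ∈ Finset.range P, ((u (i + 1) - u (i + 2) : ℤ) : ℂ) * (if c < i + 1 then 1 else 0)
      = if c < P then ((u (c + 1) - u (P + 1) : ℤ) : ℂ) else 0 := by
  induction P with
  | zero => simp
  | succ P ih =>
    rw [Finset.sum_range_succ, ih]
    rcases lt_trichotomy c P with h | rfl | h
    · rw [if_pos h, if_pos (by omega), if_pos (by omega)]
      push_cast
      ring
    · simp
    · rw [if_neg (by omega), if_neg (by omega), if_neg (by omega), mul_zero, add_zero]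

lemma sum_range_sub_mul_ite_le (u : ℕ → ℤ) {s : ℕ} (hs : 1 ≤ s) (e M : ℕ) :
    ∑ i ∈ Finset.range M, ((u (s + i - 1) - u (s + i) : ℤ) : ℂ) * (if s + i ≤ e then 1 else 0)
      = if s ≤ e then ((u (s - 1) - u (min (s + M - 1) e) : ℤ) : ℂ) else 0 := by
  induction M with
  | zero =>
    split_ifs with h
    · simp [Nat.min_eq_left (show s - 1 ≤ e by omega)]
    · rfl
  | succ M ih =>
    rw [Finset.sum_range_succ, ih]
    by_cases h1 : s ≤ e
    · rw [if_pos h1, if_pos h1]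
      by_cases h2 : s + M ≤ e
      · rw [if_pos h2, Nat.min_eq_left (by omega), Nat.min_eq_left (by omega),
          show s + (M + 1) - 1 = s + M by omega]
        push_cast
        ring
      · rw [if_neg h2, Nat.min_eq_right (by omega), Nat.min_eq_right (by omega)]
        simp
    · rw [if_neg h1, if_neg h1, if_neg (by omega)]
      simp

lemma Signature.row_weight {n : ℕ} {μ : ℕ → ℤ} {p s : ℕ} (h : Signature n μ p s) {c : ℕ}
    (hc : c < n) :
    ∑ i ∈ Finset.range p, (expA μ p i : ℂ) * (if c < i + 1 then 1 else 0)
      - ∑ i ∈ Finset.range (n + 1 - s), (expB μ s i : ℂ) * (if s + i ≤ c + 1 then 1 else 0)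
      = (μ (c + 1) : ℂ) := by
  have h1 := h.lt
  have h2 := h.le
  have h3 := h.pos_iff (c + 1) (by omega) (by omega)
  have h4 := h.neg_iff (c + 1) (by omega) (by omega)
  rw [Finset.sum_congr rfl fun i hi => by rw [h.expA_cast (Finset.mem_range.1 hi)],
    Finset.sum_congr (s₁ := Finset.range (n + 1 - s)) rfl
      fun i hi => by rw [h.expB_cast (Finset.mem_range.1 hi)],
    sum_range_sub_mul_ite_lt (fun k => if k ≤ p then μ k else 0),
    sum_range_sub_mul_ite_le (fun k => if s ≤ k then μ k else 0) (by omega)]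
  by_cases h5 : c + 1 ≤ p
  · rw [if_pos (show c < p by omega), if_neg (show ¬s ≤ c + 1 by omega), if_pos h5,
      if_neg (show ¬p + 1 ≤ p by omega), sub_zero, sub_zero]
  · rw [if_neg (show ¬c < p by omega)]
    by_cases h6 : s ≤ c + 1
    · rw [Nat.min_eq_right (by omega), if_pos h6, if_pos h6,
        if_neg (show ¬s ≤ s - 1 by omega), zero_sub, zero_sub, Int.cast_neg, neg_neg]
    · rw [if_neg h6, show μ (c + 1) = 0 by omega, Int.cast_zero, sub_zero]

lemma Top_hwPoly (μ : ℕ → ℤ) {p s : ℕ} (hp : p < s) (hs : s ≤ C.n + 1) {i j : ℕ} (hi : 1 ≤ i)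
    (him : i ≤ C.m) (hj : 1 ≤ j) (hjm : j ≤ C.m) {a : ℤ} (b : ℤ) (h : 0 < a ∨ a = 0 ∧ i < j) :
    C.Top i j a b (C.toF (C.hwPoly μ p s)) = 0 := by
  have hm := C.m_pos
  rw [Top, ← finsum_zero (α := ℤ)]
  refine finsum_congr fun k => ?_
  have h1 : 0 ≤ (k * C.m + ((j : ℤ) - 1)) + ((a - k) * C.m - i) := by
    have h2 : 0 ≤ a * C.m + j - 1 - i := by
      rcases h with h | ⟨rfl, h⟩
      · nlinarith
      · omega
    linarith
  rw [smul_assoc, Finset.sum_smul, Finset.sum_congr rfl fun c _ => by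
    rw [psiS_eq _ _ hi him, psibarS_eq _ _ hj hjm,
      nord_phi_phibar_of_comm _ _ _ _ (by omega)], hwPoly,
    sum_phi_mul_phibar_smul_toF _ _ _ hp hs h1, smul_zero]

lemma glRaiseOp_hwPoly (μ : ℕ → ℤ) {p s : ℕ} (hp : p < s) (hs : s ≤ C.n + 1) {p' : ℕ}
    (h1 : 1 ≤ p') (h2 : p' + 1 ≤ C.n) : C.glRaiseOp p' (C.toF (C.hwPoly μ p s)) = 0 := by
  have h := C.finsum_nord_psiS_psibarS_smul_toF ⟨p' - 1, by omega⟩ ⟨p', by omega⟩ _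
    (C.pderiv_hwPoly_of_le μ hp hs)
  simp only [Nat.sub_add_cancel h1] at h
  have hT : C.n ≤ C.n * C.m := Nat.le_mul_of_pos_right _ C.hm
  have hlt : (⟨p' - 1, by omega⟩ : Fin C.n) < ⟨p', by omega⟩ := Fin.mk_lt_mk.2 (by omega)
  rw [glRaiseOp, h, hwPoly, rowOp_false_detVec_of_lt _ _ _ hp hs hlt hT,
    rowOp_true_detVec_of_lt _ _ _ hp hs hlt hT, if_neg hlt.ne]
  simp

lemma Epp_hwPoly {μ : ℕ → ℤ} {p s : ℕ} (hμ : Signature C.n μ p s) {p' : ℕ} (h1 : 1 ≤ p')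
    (h2 : p' ≤ C.n) :
    C.Epp p' (C.toF (C.hwPoly μ p s)) = ((μ p' : ℤ) : ℂ) • C.toF (C.hwPoly μ p s) := by
  have h := C.finsum_nord_psiS_psibarS_smul_toF ⟨p' - 1, by omega⟩ ⟨p' - 1, by omega⟩ _
    (C.pderiv_hwPoly_of_le μ hμ.lt hμ.le)
  simp only [Nat.sub_add_cancel h1] at h
  have hT : C.n ≤ C.n * C.m := Nat.le_mul_of_pos_right _ C.hm
  have hw := hμ.row_weight (c := p' - 1) (by omega)
  rw [Nat.sub_add_cancel h1] at hw
  rw [Epp, h, if_pos trivial, add_sub_cancel_right, hwPoly,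
    rowOp_false_detVec_self _ _ _ hμ.lt hμ.le _ hT, rowOp_true_detVec_self _ _ _ hμ.lt hμ.le _ hT,
    ← sub_smul, map_smul, ← hw]
  simp only [Nat.sub_add_cancel h1]

lemma finsum_mem_qp_eq (b : ℤ) {i : ℕ} (him : i ≤ C.m) {S : Set ℤ} [DecidablePred (· ∈ S)]
    (hS : ∀ k ∈ S, -(C.n : ℤ) * C.m < k * C.m + i ∧ k * C.m + i ≤ C.n) :
    ∑ᶠ k ∈ S, C.qp b k
      = ∑ k ∈ Finset.Ico (-C.n : ℤ) (C.n + 1), if k ∈ S then C.qp b k else 0 := by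
  have hm := C.m_pos
  rw [finsum_mem_def, finsum_eq_sum_of_support_subset (s := Finset.Ico (-C.n : ℤ) (C.n + 1))]
  · exact Finset.sum_congr rfl fun k _ => Set.indicator_apply _ _ _
  · intro k hk
    have hkS : k ∈ S := by
      by_contra h
      exact hk (Set.indicator_of_notMem h _)
    have := hS k hkS
    rw [Finset.mem_coe, Finset.mem_Ico]
    constructor
    · by_contra h
      nlinarith
    · by_contra h
      nlinarith

lemma qp_zero_mul_eps (b : ℤ) : C.qp b 0 * C.eps = C.eps := by
  rcases C.hsig with h | h <;> simp [qp, eps, h]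

lemma Jsum_eq {i l : ℕ} (him : i ≤ C.m) (hl : l ≤ C.n) (b : ℤ) :
    C.Jsum i l b = ∑ k ∈ Finset.Ico (-C.n : ℤ) (C.n + 1),
      if 1 ≤ k * (C.m : ℤ) + i ∧ k * (C.m : ℤ) + i ≤ l then C.qp b k else 0 := by
  have hm := C.m_pos
  refine C.finsum_mem_qp_eq b him fun k hk => ?_
  rw [Set.mem_ofPred_eq] at hk
  exact ⟨by nlinarith, by omega⟩

lemma Jbarsum_eq {i l : ℕ} (him : i ≤ C.m) (hl : l ≤ C.n) (b : ℤ) :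
    C.Jbarsum i l b = ∑ k ∈ Finset.Ico (-C.n : ℤ) (C.n + 1),
      if 1 ≤ -(k * (C.m : ℤ)) - i + 1 ∧ -(k * (C.m : ℤ)) - i + 1 ≤ l then C.qp b k else 0 := by
  have hm := C.m_pos
  refine C.finsum_mem_qp_eq b him fun k hk => ?_
  rw [Set.mem_ofPred_eq] at hk
  exact ⟨by nlinarith, by omega⟩

lemma colWeight_eq_zero_of_le {μ : ℕ → ℤ} {p s : ℕ} (hp : p < s) (hs : s ≤ C.n + 1) {u : ℤ}
    (hu : (C.n : ℤ) ≤ u) : C.colWeight μ p s u = 0 := by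
  rw [colWeight, if_pos (by omega)]
  refine Finset.sum_eq_zero fun j hj => ?_
  rw [Finset.mem_range] at hj
  rw [if_neg (by omega), mul_zero]

lemma colWeight_eq_zero_of_lt {μ : ℕ → ℤ} {p s : ℕ} (hp : p < s) {u : ℤ}
    (hu : u < -(C.n : ℤ)) : C.colWeight μ p s u = 0 := by
  rw [colWeight, if_neg (by omega), neg_eq_zero]
  refine Finset.sum_eq_zero fun j hj => ?_
  rw [Finset.mem_range] at hj
  rw [if_neg (by omega), mul_zero]

lemma sum_qp_mul_colWeight (μ : ℕ → ℤ) {p s : ℕ} (hp : p < s) (hs : s ≤ C.n + 1) {i : ℕ}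
    (him : i ≤ C.m) (b : ℤ) :
    ∑ k ∈ Finset.Ico (-C.n : ℤ) (C.n + 1), C.qp b k * C.colWeight μ p s (k * C.m + (i - 1))
      = ∑ j ∈ Finset.range p, expA μ p j * C.Jsum i (j + 1) b
        - ∑ j ∈ Finset.range (C.n + 1 - s), expB μ s j * C.Jbarsum i (C.n - (s + j) + 1) b := by
  rw [Finset.sum_congr (s₁ := Finset.range p) rfl fun j hj => by
      rw [C.Jsum_eq him (by have := Finset.mem_range.1 hj; omega), Finset.mul_sum],
    Finset.sum_congr (s₁ := Finset.range (C.n + 1 - s)) rfl fun j hj => by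
      rw [C.Jbarsum_eq him (by have := Finset.mem_range.1 hj; omega), Finset.mul_sum],
    Finset.sum_comm, Finset.sum_comm (s := Finset.range (C.n + 1 - s)), ← Finset.sum_sub_distrib]
  refine Finset.sum_congr rfl fun k _ => ?_
  generalize hx : k * (C.m : ℤ) = x
  rw [colWeight]
  split_ifs with hu
  · rw [Finset.sum_eq_zero (s := Finset.range (C.n + 1 - s))
      fun j _ => by rw [if_neg (by omega), mul_zero], sub_zero, Finset.mul_sum]
    refine Finset.sum_congr rfl fun j _ => ?_
    rw [mul_left_comm, mul_ite, mul_one, mul_zero]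
    congr 1
    exact if_congr (by omega) rfl rfl
  · rw [Finset.sum_eq_zero (s := Finset.range p)
      fun j _ => by rw [if_neg (by omega), mul_zero], zero_sub, mul_neg, Finset.mul_sum]
    congr 1
    refine Finset.sum_congr rfl fun j _ => ?_
    rw [mul_left_comm, mul_ite, mul_one, mul_zero]
    congr 1
    exact if_congr (by omega) rfl rfl

lemma sum_expA_mul {μ : ℕ → ℤ} {p s : ℕ} (hμ : Signature C.n μ p s) (J : ℕ → ℂ) :
    ∑ j ∈ Finset.range p, expA μ p j * J (j + 1)
      = ∑ k ∈ Finset.Ico 1 p, ((μ k - μ (k + 1) : ℤ) : ℂ) * J k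
        + if 1 ≤ p then (μ p : ℂ) * J p else 0 := by
  rw [Finset.sum_congr rfl fun j hj => by rw [hμ.expA_cast (Finset.mem_range.1 hj)]]
  cases p with
  | zero => simp
  | succ p =>
    rw [Finset.sum_range_succ, if_pos (by omega), Finset.sum_Ico_eq_sum_range]
    refine congrArg₂ _ (Finset.sum_congr rfl fun j hj => ?_) ?_
    · have := Finset.mem_range.1 hj
      rw [if_pos (by omega), if_pos (by omega), add_comm 1 j]
    · rw [if_neg (show ¬p + 2 ≤ p + 1 by omega), sub_zero, if_pos (show 1 ≤ p + 1 by omega)]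

lemma sum_expB_mul {μ : ℕ → ℤ} {p s : ℕ} (hμ : Signature C.n μ p s) (J : ℕ → ℂ) :
    ∑ j ∈ Finset.range (C.n + 1 - s), expB μ s j * J (C.n - (s + j) + 1)
      = ∑ k ∈ Finset.Icc (s + 1) C.n, ((μ (k - 1) - μ k : ℤ) : ℂ) * J (C.n - k + 1)
        - if s ≤ C.n then (μ s : ℂ) * J (C.n - s + 1) else 0 := by
  have h1 := hμ.lt
  rw [Finset.sum_congr rfl fun j hj => by rw [hμ.expB_cast (Finset.mem_range.1 hj)]]
  by_cases h : s ≤ C.n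
  · rw [if_pos h, ← Finset.Ico_add_one_right_eq_Icc, Finset.sum_Ico_eq_sum_range,
      show C.n + 1 - s = C.n + 1 - (s + 1) + 1 by omega, Finset.sum_range_succ']
    refine (congrArg₂ (· + ·) (Finset.sum_congr rfl fun j _ => ?_) ?_).trans
      (sub_eq_add_neg _ _).symm
    · rw [if_pos (show s ≤ s + (j + 1) - 1 by omega), if_pos (show s ≤ s + (j + 1) by omega),
        show s + (j + 1) = s + 1 + j by omega]
    · rw [if_neg (show ¬s ≤ s + 0 - 1 by omega), if_pos (show s ≤ s + 0 by omega), add_zero]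
      push_cast
      ring
  · rw [if_neg h, Finset.Icc_eq_empty (by omega), show C.n + 1 - s = 0 by omega]
    simp

lemma Eib_hwPoly {μ : ℕ → ℤ} {p s : ℕ} (hμ : Signature C.n μ p s) {i : ℕ} (hi : 1 ≤ i)
    (him : i ≤ C.m) (b : ℤ) :
    C.Eib i b (C.toF (C.hwPoly μ p s)) = C.etaGL μ p s i b • C.toF (C.hwPoly μ p s) := by
  have hm := C.m_pos
  have hterm : ∀ k : ℤ, (C.qp b k • ∑ c : Fin C.n, C.nord (C.psiS i ((c : ℕ) + 1) (-k - C.sig)) k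
        (C.psibarS i ((c : ℕ) + 1) k)) • C.toF (C.hwPoly μ p s)
      = (C.qp b k * C.colWeight μ p s (k * C.m + (i - 1))
          + if k = 0 then C.eps * C.n else 0) • C.toF (C.hwPoly μ p s) := by
    intro k
    rw [smul_assoc, Finset.sum_smul, Finset.sum_congr rfl fun c _ =>
      C.nord_psiS_psibarS_smul_toF c c hi him k _]
    simp only [true_and]
    rw [Finset.sum_add_distrib, ← map_sum,
      sum_modeOp_hwPoly, map_smul, Finset.sum_const, Finset.card_univ, Fintype.card_fin,
      ← Nat.cast_smul_eq_nsmul ℂ, smul_smul, ← add_smul, smul_smul, mul_add]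
    congr 2
    by_cases hk : k = 0
    · subst hk
      simp only [if_true]
      rw [mul_left_comm, qp_zero_mul_eps, mul_comm]
    · simp [hk]
  rw [Eib, finsum_congr hterm,
    finsum_eq_sum_of_support_subset (s := Finset.Ico (-C.n : ℤ) (C.n + 1)), ← Finset.sum_smul,
    ← sub_smul, Finset.sum_add_distrib, sum_qp_mul_colWeight _ _ hμ.lt hμ.le him,
    C.sum_expA_mul hμ fun l => C.Jsum i l b, C.sum_expB_mul hμ fun l => C.Jbarsum i l b,
    Finset.sum_ite_eq',
    if_pos (show (0 : ℤ) ∈ Finset.Ico (-C.n : ℤ) (C.n + 1) from Finset.mem_Ico.2 (by omega)),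
    etaGL]
  · congr 1
    ring
  · intro k hk
    rw [Finset.mem_coe, Finset.mem_Ico]
    by_contra h
    refine hk ?_
    simp only
    have hn := C.hn
    have him' : (i : ℤ) ≤ C.m := mod_cast him
    have hi' : (1 : ℤ) ≤ i := mod_cast hi
    rcases lt_or_ge k 0 with h0 | h0
    · have h1 : k + C.n + 1 ≤ 0 := by omega
      rw [colWeight_eq_zero_of_lt _ hμ.lt (by nlinarith), if_neg h0.ne, mul_zero, add_zero,
        zero_smul]
    · have h1 : (C.n : ℤ) + 1 ≤ k := by omega
      rw [colWeight_eq_zero_of_le _ hμ.lt hμ.le (by nlinarith), if_neg (by omega), mul_zero,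
        add_zero, zero_smul]

end WCtx

open WCtx in
/-- **Proposition 5.8.**  For a weakly decreasing `μ ∈ ℤ^n` with `p` positive parts
and `n+1-s` negative parts, the vector `v_{μ,S}` is a nonzero joint highest weight
vector for the dual pair `(GL_n, ĝl_m(C_q))` acting on `F_N(S)`, with highest weight
`(μ, η_{μ,S})`. -/
theorem statement11 (C : WCtx) (μ : ℕ → ℤ)
    (hdec : ∀ k : ℕ, 1 ≤ k → k < C.n → μ (k + 1) ≤ μ k)
    (p s : ℕ)
    (hp : p = ((Finset.Icc 1 C.n).filter fun k => 0 < μ k).card)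
    (hs : s = C.n + 1 - ((Finset.Icc 1 C.n).filter fun k => μ k < 0).card) :
    C.vGL μ p s ≠ 0
    ∧ (∀ i j : ℕ, 1 ≤ i → i ≤ C.m → 1 ≤ j → j ≤ C.m → ∀ a b : ℤ,
        (0 < a ∨ (a = 0 ∧ i < j)) → C.Top i j a b (C.vGL μ p s) = 0)
    ∧ (∀ i : ℕ, 1 ≤ i → i ≤ C.m → ∀ b : ℤ,
        C.Eib i b (C.vGL μ p s) = C.etaGL μ p s i b • C.vGL μ p s)
    ∧ (∀ p' : ℕ, 1 ≤ p' → p' + 1 ≤ C.n → C.glRaiseOp p' (C.vGL μ p s) = 0)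
    ∧ (∀ p' : ℕ, 1 ≤ p' → p' ≤ C.n →
        C.Epp p' (C.vGL μ p s) = ((μ p' : ℤ) : ℂ) • C.vGL μ p s) := by
  subst hp hs
  have hμ := signature_of_card hdec
  rw [C.vGL_eq μ hμ.lt hμ.le]
  exact ⟨C.toF_ne_zero (DetVector.detVec_ne_zero C.hn _ _ hμ.lt hμ.le),
    fun i j hi him hj hjm a b h => C.Top_hwPoly μ hμ.lt hμ.le hi him hj hjm b h,
    fun i hi him b => C.Eib_hwPoly hμ hi him b,
    fun p' h1 h2 => C.glRaiseOp_hwPoly μ hμ.lt hμ.le h1 h2,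
    fun p' h1 h2 => C.Epp_hwPoly hμ h1 h2⟩
end
end
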